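/- Single-letterization for classical-quantum systems: Let ρ^{XB} be a classical-quantum state with purification on XBE, and for n ≥ 1 define P_n(R) = max_{Y|X^n} { (1/n) I(Y;B^n) : (1/n) I(Y;B^nE^n) ≤ R }, the maximum over classical channels Y|X^n applied to the classical system X^n of (ρ^{XB})^{⊗n}. Then for all R ≥ 0 and all n ≥ 1, P_n(R) = P_1(R). -/

import Mathlib

noncomputable section
namespace LPD

open Matrix Kronecker BigOperators Filter Finset
open scoped ComplexOrder

/-- The positive semidefinite square root of a positive semidefinite matrix (the definition
of the older Mathlib, from which it has since been removed). -/
def _root_.Matrix.PosSemidef.sqrt {n 𝕜 : Type*} [Fintype n] [RCLike 𝕜] [DecidableEq n]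
    {A : Matrix n n 𝕜} (hA : A.PosSemidef) : Matrix n n 𝕜 :=
  hA.1.eigenvectorUnitary.1 * diagonal ((↑) ∘ Real.sqrt ∘ hA.1.eigenvalues) *
    (star hA.1.eigenvectorUnitary : Matrix n n 𝕜)

/-- The trace norm `‖ω‖₁ = Tr √(ωᴴ ω)` of a matrix. -/
def traceNorm {ι : Type*} [Fintype ι] [DecidableEq ι] (ω : Matrix ι ι ℂ) : ℝ :=
  ((Matrix.posSemidef_conjTranspose_mul_self ω).sqrt).trace.re

/-- A density operator: positive semidefinite with trace one. -/
def IsDensity {ι : Type*} [Fintype ι] (ρ : Matrix ι ι ℂ) : Prop :=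
  ρ.PosSemidef ∧ ρ.trace = 1

/-- The von Neumann entropy `H(ρ) = -Tr(ρ log ρ)`, expressed via eigenvalues
(with the convention `0 log 0 = 0`, and junk value `0` on non-Hermitian input). -/
def entropy {ι : Type*} [Fintype ι] [DecidableEq ι] (ρ : Matrix ι ι ℂ) : ℝ :=
  letI := Classical.dec ρ.IsHermitian
  if h : ρ.IsHermitian then -∑ i, h.eigenvalues i * Real.log (h.eigenvalues i) else 0

/-- Partial trace over the first (left) tensor factor. -/
def ptraceLeft {α β : Type*} [Fintype α] (ρ : Matrix (α × β) (α × β) ℂ) : Matrix β β ℂ :=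
  fun b b' => ∑ a, ρ (a, b) (a, b')

/-- Partial trace over the second (right) tensor factor. -/
def ptraceRight {α β : Type*} [Fintype β] (ρ : Matrix (α × β) (α × β) ℂ) : Matrix α α ℂ :=
  fun a a' => ∑ b, ρ (a, b) (a', b)

/-- Quantum mutual information `I(A;B) = H(A) + H(B) - H(AB)` of a bipartite state. -/
def mutualInfo {α β : Type*} [Fintype α] [DecidableEq α] [Fintype β] [DecidableEq β]
    (ρ : Matrix (α × β) (α × β) ℂ) : ℝ :=
  entropy (ptraceRight ρ) + entropy (ptraceLeft ρ) - entropy ρ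

/-- Conditional entropy `H(B|A) = H(AB) - H(A)` (second system conditioned on the first). -/
def condEntropySnd {α β : Type*} [Fintype α] [DecidableEq α] [Fintype β] [DecidableEq β]
    (ρ : Matrix (α × β) (α × β) ℂ) : ℝ :=
  entropy ρ - entropy (ptraceRight ρ)

/-- Conditional entropy `H(A|B) = H(AB) - H(B)` (first system conditioned on the second). -/
def condEntropyFst {α β : Type*} [Fintype α] [DecidableEq α] [Fintype β] [DecidableEq β]
    (ρ : Matrix (α × β) (α × β) ℂ) : ℝ :=
  entropy ρ - entropy (ptraceLeft ρ)

/-- `n`-fold tensor power of a matrix. -/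
def tpow {ι : Type*} (ρ : Matrix ι ι ℂ) (n : ℕ) : Matrix (Fin n → ι) (Fin n → ι) ℂ :=
  fun x y => ∏ k, ρ (x k) (y k)

/-- `n`-fold tensor power of a bipartite state, with the `A` and `B` factors collected. -/
def tpowAB {α β : Type*} (ρ : Matrix (α × β) (α × β) ℂ) (n : ℕ) :
    Matrix ((Fin n → α) × (Fin n → β)) ((Fin n → α) × (Fin n → β)) ℂ :=
  Matrix.reindex (Equiv.arrowProdEquivProdArrow (Fin n) (fun _ => α) (fun _ => β))
    (Equiv.arrowProdEquivProdArrow (Fin n) (fun _ => α) (fun _ => β)) (tpow ρ n)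

/-- A POVM on the system `ι` with outcome set `κ`. -/
structure POVM (ι κ : Type*) [Fintype ι] [DecidableEq ι] [Fintype κ] where
  elem : κ → Matrix ι ι ℂ
  pos : ∀ y, (elem y).PosSemidef
  sum_eq : ∑ y, elem y = 1

/-- Apply a POVM to the first factor of a bipartite state, recording the outcome in a
classical register: `ρ^{AΓ} ↦ Σ_y |y⟩⟨y| ⊗ Tr_A((Λ_y ⊗ 1)ρ)`. -/
def measureLeft {ι κ γ : Type*} [Fintype ι] [DecidableEq ι] [Fintype κ] [DecidableEq κ]
    (Λ : POVM ι κ) (ρ : Matrix (ι × γ) (ι × γ) ℂ) : Matrix (κ × γ) (κ × γ) ℂ :=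
  fun p q => if p.1 = q.1 then ∑ a, ∑ a', (Λ.elem p.1) a a' * ρ (a', p.2) (a, q.2) else 0

/-- The canonical purification of a density operator `ρ` on `ι`, a pure state on `ι × ι`
(junk value `0` for non-positive-semidefinite input). -/
def canonicalPurification {ι : Type*} [Fintype ι] [DecidableEq ι] (ρ : Matrix ι ι ℂ) :
    Matrix (ι × ι) (ι × ι) ℂ :=
  letI := Classical.dec ρ.PosSemidef
  if h : ρ.PosSemidef then
    vecMulVec (fun p => h.sqrt p.1 p.2) (star fun p => h.sqrt p.1 p.2)
  else 0

/-- The purity `κ(ρ) = log d - H(ρ)`. -/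
def kappa {ι : Type*} [Fintype ι] [DecidableEq ι] (ρ : Matrix ι ι ℂ) : ℝ :=
  Real.log (Fintype.card ι) - entropy ρ

/-- The pure state `|0⟩⟨0|` on a `d`-dimensional system. -/
def pureZero (d : ℕ) : Matrix (Fin d) (Fin d) ℂ :=
  fun i j => if i.val = 0 ∧ j.val = 0 then 1 else 0

/-! ### Index bookkeeping equivalences -/

/-- `(a × b) × c ≃ (a × c) × b`. -/
def swapE (a b c : Type*) : (a × b) × c ≃ (a × c) × b where
  toFun x := ((x.1.1, x.2), x.1.2)
  invFun x := ((x.1.1, x.2), x.1.2)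
  left_inv _ := rfl
  right_inv _ := rfl

/-- Pull the `Y` register to the front: `((a × y) × g) × b ≃ y × ((a × g) × b)`. -/
def pullY (a y g b : Type*) : ((a × y) × g) × b ≃ y × ((a × g) × b) where
  toFun x := (x.1.1.2, ((x.1.1.1, x.1.2), x.2))
  invFun x := (((x.2.1.1, x.1), x.2.1.2), x.2.2)
  left_inv _ := rfl
  right_inv _ := rfl

/-- Rearrange for Bob's unitary: `((a × y) × g) × b ≃ (b × y) × (a × g)`. -/
def pullBY (a y g b : Type*) : ((a × y) × g) × b ≃ (b × y) × (a × g) where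
  toFun x := ((x.2, x.1.1.2), (x.1.1.1, x.1.2))
  invFun x := (((x.2.1, x.1.2), x.2.2), x.1.1)
  left_inv _ := rfl
  right_inv _ := rfl

/-- Collect `Y` and `B` together: `((a × y) × g) × b ≃ (y × b) × (a × g)`. -/
def pullYB (a y g b : Type*) : ((a × y) × g) × b ≃ (y × b) × (a × g) where
  toFun x := ((x.1.1.2, x.2), (x.1.1.1, x.1.2))
  invFun x := (((x.2.1, x.1.1), x.2.2), x.1.2)
  left_inv _ := rfl
  right_inv _ := rfl

/-- Sort output registers: `(bp × bg) × (ap × ag) ≃ (ap × bp) × (ag × bg)`. -/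
def sortOut (bp bg ap ag : Type*) : (bp × bg) × (ap × ag) ≃ (ap × bp) × (ag × bg) where
  toFun x := ((x.2.1, x.1.1), (x.2.2, x.1.2))
  invFun x := ((x.1.2, x.2.2), (x.1.1, x.2.1))
  left_inv _ := rfl
  right_inv _ := rfl

/-- `y × (x × w) ≃ (y × w) × x`. -/
def exYW (y x w : Type*) : y × (x × w) ≃ (y × w) × x where
  toFun a := ((a.1, a.2.2), a.2.1)
  invFun a := (a.1.1, (a.2, a.1.2))
  left_inv _ := rfl
  right_inv _ := rfl

/-- `y × (x × w) ≃ (y × x) × w`. -/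
def exYX (y x w : Type*) : y × (x × w) ≃ (y × x) × w where
  toFun a := ((a.1, a.2.1), a.2.2)
  invFun a := (a.1.1, (a.1.2, a.2))
  left_inv _ := rfl
  right_inv _ := rfl

/-- `y × (x × (b × e)) ≃ (y × b) × (x × e)`. -/
def exYB (y x b e : Type*) : y × (x × (b × e)) ≃ (y × b) × (x × e) where
  toFun a := ((a.1, a.2.2.1), (a.2.1, a.2.2.2))
  invFun a := (a.1.1, (a.2.1, (a.1.2, a.2.2)))
  left_inv _ := rfl
  right_inv _ := rfl

/-! ### The state `σ^{YBE}` obtained by measuring Alice's share of a purification -/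

/-- The canonical purification of a bipartite state `ρ^{AB}`, with indices arranged as
`A × (B × E)` where `E = A × B`. -/
def purifyAssoc {α β : Type*} [Fintype α] [DecidableEq α] [Fintype β] [DecidableEq β]
    (ρ : Matrix (α × β) (α × β) ℂ) :
    Matrix (α × (β × (α × β))) (α × (β × (α × β))) ℂ :=
  Matrix.reindex (Equiv.prodAssoc α β (α × β)) (Equiv.prodAssoc α β (α × β))
    (canonicalPurification ρ)

/-- `σ^{YBE} = (Λ ⊗ 1^{BE})(Ψ^{ABE})` for the canonical purification `Ψ` of `ρ^{AB}`. -/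
def sigmaOf {α β κ : Type*} [Fintype α] [DecidableEq α] [Fintype β] [DecidableEq β]
    [Fintype κ] [DecidableEq κ] (ρ : Matrix (α × β) (α × β) ℂ) (Λ : POVM α κ) :
    Matrix (κ × (β × (α × β))) (κ × (β × (α × β))) ℂ :=
  measureLeft Λ (purifyAssoc ρ)

/-- `I(Y;B)` evaluated on a state of the form `σ^{Y(BE)}`: trace out `E`, then take the
mutual information. -/
def IYB {κ β ε : Type*} [Fintype κ] [DecidableEq κ] [Fintype β] [DecidableEq β] [Fintype ε]
    (σ : Matrix (κ × (β × ε)) (κ × (β × ε)) ℂ) : ℝ :=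
  mutualInfo (ptraceRight (Matrix.reindex (Equiv.prodAssoc κ β ε).symm
    (Equiv.prodAssoc κ β ε).symm σ))

/-- `I(Y;BE)` evaluated on a state of the form `σ^{Y(BE)}`. -/
def IYBE {κ β ε : Type*} [Fintype κ] [DecidableEq κ] [Fintype β] [DecidableEq β] [Fintype ε]
    [DecidableEq ε] (σ : Matrix (κ × (β × ε)) (κ × (β × ε)) ℂ) : ℝ :=
  mutualInfo σ

/-- `P^{(1)}_→(ρ^{AB}, R) = max_Λ { I(Y;B)_σ : I(Y;BE)_σ ≤ R }`, the maximum over all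
POVMs on Alice's system. -/
def P1 {α β : Type*} [Fintype α] [DecidableEq α] [Fintype β] [DecidableEq β]
    (ρ : Matrix (α × β) (α × β) ℂ) (R : ℝ) : ℝ :=
  sSup { v : ℝ | ∃ (m : ℕ) (Λ : POVM α (Fin m)),
    IYBE (sigmaOf ρ Λ) ≤ R ∧ v = IYB (sigmaOf ρ Λ) }

/-! ### Local purity distillation protocols -/

/-- An `(n, ·, ·, ·)` local purity distillation protocol: Alice's unitary
`U_A : H_{A^n} ⊗ H_C → H_{A_p} ⊗ H_Y ⊗ H_{A_g}`, a dephasing channel on `Y`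
(applied below), and Bob's unitary `U_B : H_{B^n} ⊗ H_Y → H_{B_p} ⊗ H_{B_g}`. -/
structure Protocol (α β : Type*) [Fintype α] [DecidableEq α] [Fintype β] [DecidableEq β]
    (n : ℕ) where
  dC : ℕ
  dAp : ℕ
  dY : ℕ
  dAg : ℕ
  dBp : ℕ
  dBg : ℕ
  dC_pos : 0 < dC
  dAp_pos : 0 < dAp
  dY_pos : 0 < dY
  dAg_pos : 0 < dAg
  dBp_pos : 0 < dBp
  dBg_pos : 0 < dBg
  UA : Matrix ((Fin dAp × Fin dY) × Fin dAg) ((Fin n → α) × Fin dC) ℂ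
  UA_unitary : UAᴴ * UA = 1 ∧ UA * UAᴴ = 1
  UB : Matrix (Fin dBp × Fin dBg) ((Fin n → β) × Fin dY) ℂ
  UB_unitary : UBᴴ * UB = 1 ∧ UB * UBᴴ = 1

variable {α β : Type*} [Fintype α] [DecidableEq α] [Fintype β] [DecidableEq β]

/-- The input state `(ρ^{AB})^{⊗n} ⊗ |0⟩⟨0|^C`, arranged as `(A^n × C) × B^n`. -/
def inputState (ρ : Matrix (α × β) (α × β) ℂ) {n : ℕ} (Pr : Protocol α β n) :
    Matrix (((Fin n → α) × Fin Pr.dC) × (Fin n → β))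
      (((Fin n → α) × Fin Pr.dC) × (Fin n → β)) ℂ :=
  Matrix.reindex (swapE (Fin n → α) (Fin n → β) (Fin Pr.dC))
    (swapE (Fin n → α) (Fin n → β) (Fin Pr.dC)) (tpowAB ρ n ⊗ₖ pureZero Pr.dC)

/-- The state `U_A((ρ^{AB})^{⊗n} ⊗ |0⟩⟨0|^C)` (before dephasing), on
`((A_p × Y) × A_g) × B^n`. -/
def stateAfterUA (ρ : Matrix (α × β) (α × β) ℂ) {n : ℕ} (Pr : Protocol α β n) :
    Matrix (((Fin Pr.dAp × Fin Pr.dY) × Fin Pr.dAg) × (Fin n → β))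
      (((Fin Pr.dAp × Fin Pr.dY) × Fin Pr.dAg) × (Fin n → β)) ℂ :=
  (Pr.UA ⊗ₖ (1 : Matrix (Fin n → β) (Fin n → β) ℂ)) * inputState ρ Pr *
    (Pr.UA ⊗ₖ (1 : Matrix (Fin n → β) (Fin n → β) ℂ))ᴴ

/-- Dephase the first tensor factor in a fixed basis. -/
def dephaseFst {κ γ : Type*} [DecidableEq κ] (ρ : Matrix (κ × γ) (κ × γ) ℂ) :
    Matrix (κ × γ) (κ × γ) ℂ :=
  fun p q => if p.1 = q.1 then ρ p q else 0

/-- The state after Alice's unitary and the dephasing channel on `Y`. -/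
def stateAfterDephasing (ρ : Matrix (α × β) (α × β) ℂ) {n : ℕ} (Pr : Protocol α β n) :
    Matrix (((Fin Pr.dAp × Fin Pr.dY) × Fin Pr.dAg) × (Fin n → β))
      (((Fin Pr.dAp × Fin Pr.dY) × Fin Pr.dAg) × (Fin n → β)) ℂ :=
  Matrix.reindex (pullY (Fin Pr.dAp) (Fin Pr.dY) (Fin Pr.dAg) (Fin n → β)).symm
    (pullY (Fin Pr.dAp) (Fin Pr.dY) (Fin Pr.dAg) (Fin n → β)).symm
    (dephaseFst (Matrix.reindex (pullY (Fin Pr.dAp) (Fin Pr.dY) (Fin Pr.dAg) (Fin n → β))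
      (pullY (Fin Pr.dAp) (Fin Pr.dY) (Fin Pr.dAg) (Fin n → β)) (stateAfterUA ρ Pr)))

/-- The final state `Υ`, after Bob's unitary, on `(B_p × B_g) × (A_p × A_g)`. -/
def stateAfterUB (ρ : Matrix (α × β) (α × β) ℂ) {n : ℕ} (Pr : Protocol α β n) :
    Matrix ((Fin Pr.dBp × Fin Pr.dBg) × (Fin Pr.dAp × Fin Pr.dAg))
      ((Fin Pr.dBp × Fin Pr.dBg) × (Fin Pr.dAp × Fin Pr.dAg)) ℂ :=
  (Pr.UB ⊗ₖ (1 : Matrix (Fin Pr.dAp × Fin Pr.dAg) (Fin Pr.dAp × Fin Pr.dAg) ℂ)) *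
    Matrix.reindex (pullBY (Fin Pr.dAp) (Fin Pr.dY) (Fin Pr.dAg) (Fin n → β))
      (pullBY (Fin Pr.dAp) (Fin Pr.dY) (Fin Pr.dAg) (Fin n → β)) (stateAfterDephasing ρ Pr) *
    (Pr.UB ⊗ₖ (1 : Matrix (Fin Pr.dAp × Fin Pr.dAg) (Fin Pr.dAp × Fin Pr.dAg) ℂ))ᴴ

/-- The reduced output state `Υ^{A_p B_p}`. -/
def outputReduced (ρ : Matrix (α × β) (α × β) ℂ) {n : ℕ} (Pr : Protocol α β n) :
    Matrix (Fin Pr.dAp × Fin Pr.dBp) (Fin Pr.dAp × Fin Pr.dBp) ℂ :=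
  ptraceRight (Matrix.reindex
    (sortOut (Fin Pr.dBp) (Fin Pr.dBg) (Fin Pr.dAp) (Fin Pr.dAg))
    (sortOut (Fin Pr.dBp) (Fin Pr.dBg) (Fin Pr.dAp) (Fin Pr.dAg)) (stateAfterUB ρ Pr))

/-- The error of a protocol: trace distance of `Υ^{A_p B_p}` from `|0⟩⟨0| ⊗ |0⟩⟨0|`. -/
def protocolError (ρ : Matrix (α × β) (α × β) ℂ) {n : ℕ} (Pr : Protocol α β n) : ℝ :=
  traceNorm (outputReduced ρ Pr - pureZero Pr.dAp ⊗ₖ pureZero Pr.dBp)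

/-- The classical communication rate `(1/n) log d_Y` of a protocol. -/
def commRate {n : ℕ} (Pr : Protocol α β n) : ℝ := Real.log Pr.dY / n

/-- The purity rate `(1/n)(log d_{A_p}d_{B_p} - log d_C)` of a protocol. -/
def purityRate {n : ℕ} (Pr : Protocol α β n) : ℝ :=
  (Real.log (Pr.dAp * Pr.dBp) - Real.log Pr.dC) / n

/-- Achievability of a rate pair `(P, R)`: for all `ε, δ > 0` and all sufficiently large `n`
there is an `(n, R+δ, P-δ, ε)` protocol. -/
def Achievable (ρ : Matrix (α × β) (α × β) ℂ) (P R : ℝ) : Prop :=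
  ∀ ε > (0 : ℝ), ∀ δ > (0 : ℝ), ∃ N : ℕ, ∀ n ≥ N, ∃ Pr : Protocol α β n,
    commRate Pr ≤ R + δ ∧ P - δ ≤ purityRate Pr ∧ protocolError ρ Pr ≤ ε

/-- The 1-way distillable local purity `κ_→(ρ^{AB}, R)`. -/
def kappaArrow (ρ : Matrix (α × β) (α × β) ℂ) (R : ℝ) : ℝ :=
  sSup { P : ℝ | Achievable ρ P R }

/-- `I(Y;B^n)` on the pre-dephasing state `U_A((ρ^{AB})^{⊗n} ⊗ |0⟩⟨0|^C)`. -/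
def preDephIYB (ρ : Matrix (α × β) (α × β) ℂ) {n : ℕ} (Pr : Protocol α β n) : ℝ :=
  mutualInfo (ptraceRight (Matrix.reindex
    (pullYB (Fin Pr.dAp) (Fin Pr.dY) (Fin Pr.dAg) (Fin n → β))
    (pullYB (Fin Pr.dAp) (Fin Pr.dY) (Fin Pr.dAg) (Fin n → β)) (stateAfterUA ρ Pr)))

/-- The pre-dephasing state together with the purifying environment `E^n`:
`(U_A ⊗ 1^{B^nE^n})((Ψ^{ABE})^{⊗n} ⊗ |0⟩⟨0|^C)`, where `Ψ` is the canonical purification. -/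
def preDephWithEnv (ρ : Matrix (α × β) (α × β) ℂ) {n : ℕ} (Pr : Protocol α β n) :
    Matrix (((Fin Pr.dAp × Fin Pr.dY) × Fin Pr.dAg) × (Fin n → β × (α × β)))
      (((Fin Pr.dAp × Fin Pr.dY) × Fin Pr.dAg) × (Fin n → β × (α × β))) ℂ :=
  (Pr.UA ⊗ₖ (1 : Matrix (Fin n → β × (α × β)) (Fin n → β × (α × β)) ℂ)) *
    Matrix.reindex (swapE (Fin n → α) (Fin n → β × (α × β)) (Fin Pr.dC))
      (swapE (Fin n → α) (Fin n → β × (α × β)) (Fin Pr.dC))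
      (tpowAB (purifyAssoc ρ) n ⊗ₖ pureZero Pr.dC) *
    (Pr.UA ⊗ₖ (1 : Matrix (Fin n → β × (α × β)) (Fin n → β × (α × β)) ℂ))ᴴ

/-- `I(Y;B^nE^n)` on the pre-dephasing state, including the purifying environment. -/
def preDephIYBE (ρ : Matrix (α × β) (α × β) ℂ) {n : ℕ} (Pr : Protocol α β n) : ℝ :=
  mutualInfo (ptraceRight (Matrix.reindex
    (pullYB (Fin Pr.dAp) (Fin Pr.dY) (Fin Pr.dAg) (Fin n → β × (α × β)))
    (pullYB (Fin Pr.dAp) (Fin Pr.dY) (Fin Pr.dAg) (Fin n → β × (α × β)))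
    (preDephWithEnv ρ Pr)))

/-- `H(Y)` on the pre-dephasing state. -/
def preDephHY (ρ : Matrix (α × β) (α × β) ℂ) {n : ℕ} (Pr : Protocol α β n) : ℝ :=
  entropy (ptraceRight (Matrix.reindex
    (pullY (Fin Pr.dAp) (Fin Pr.dY) (Fin Pr.dAg) (Fin n → β))
    (pullY (Fin Pr.dAp) (Fin Pr.dY) (Fin Pr.dAg) (Fin n → β)) (stateAfterUA ρ Pr)))

/-! ### Single-party purity concentration -/

/-- An `(n, ·, ·)` purity concentration protocol: a unitary
`U : H_{A^n} → H_{A_p} ⊗ H_{A_g}`. -/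
structure ConcProtocol (α : Type*) [Fintype α] [DecidableEq α] (n : ℕ) where
  dAp : ℕ
  dAg : ℕ
  dAp_pos : 0 < dAp
  dAg_pos : 0 < dAg
  U : Matrix (Fin dAp × Fin dAg) (Fin n → α) ℂ
  U_unitary : Uᴴ * U = 1 ∧ U * Uᴴ = 1

/-- The reduced state `Υ^{A_p}` of `U ρ^{⊗n} U†`. -/
def concOutput {α : Type*} [Fintype α] [DecidableEq α] (ρ : Matrix α α ℂ) {n : ℕ}
    (Pr : ConcProtocol α n) : Matrix (Fin Pr.dAp) (Fin Pr.dAp) ℂ :=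
  ptraceRight (Pr.U * tpow ρ n * Pr.Uᴴ)

/-- Achievability of a purity-concentration rate `P`. -/
def ConcAchievable {α : Type*} [Fintype α] [DecidableEq α] (ρ : Matrix α α ℂ) (P : ℝ) :
    Prop :=
  ∀ ε > (0 : ℝ), ∀ δ > (0 : ℝ), ∃ N : ℕ, ∀ n ≥ N, ∃ Pr : ConcProtocol α n,
    P - δ ≤ Real.log Pr.dAp / n ∧ traceNorm (concOutput ρ Pr - pureZero Pr.dAp) ≤ ε

/-- The purity `κ(ρ)`: the supremum of all achievable concentration rates. -/
def kappaConc {α : Type*} [Fintype α] [DecidableEq α] (ρ : Matrix α α ℂ) : ℝ :=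
  sSup { P : ℝ | ConcAchievable ρ P }

/-! ### Measurement compression -/

/-- The averaged compressed-measurement map
`σ ↦ (1/|L|) Σ_l Σ_m Tr(Λ̃^{(l)}_m σ) |f(m,l)⟩⟨f(m,l)|`, applied to the first factor. -/
def mcMap {A Ω γ' : Type*} [Fintype A] [DecidableEq A] [Fintype Ω] [DecidableEq Ω]
    (L M : ℕ) (Λt : Fin L → POVM A (Fin M)) (f : Fin M → Fin L → Ω)
    (ρ : Matrix (A × γ') (A × γ') ℂ) : Matrix (Ω × γ') (Ω × γ') ℂ :=
  fun p q => (L : ℂ)⁻¹ * ∑ l, ∑ m, (if f m l = p.1 ∧ f m l = q.1 then 1 else 0) *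
    ∑ a, ∑ a', ((Λt l).elem m) a a' * ρ (a', p.2) (a, q.2)

/-! ### Classical-quantum states and classical channels -/

/-- The classical-quantum state `Σ_x p(x) |x⟩⟨x| ⊗ ρ_x`. -/
def cqState {𝒳 B : Type*} [DecidableEq 𝒳] (p : 𝒳 → ℝ) (ρx : 𝒳 → Matrix B B ℂ) :
    Matrix (𝒳 × B) (𝒳 × B) ℂ :=
  fun P Q => if P.1 = Q.1 then (p P.1 : ℂ) * ρx P.1 P.2 Q.2 else 0

/-- The state on `Y × (X × W)` obtained from a purification vector `ψ` of a cq state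
(with classical system `X` and the rest `W`) by applying a classical channel `q(y|x)`
to the classical system: `Σ_{x,y} q(y|x) |y⟩⟨y| ⊗ |x⟩⟨x|-block of p(x)·(BE state given x)`. -/
def chanState {𝒳 W 𝒴 : Type*} [DecidableEq 𝒳] [DecidableEq 𝒴]
    (ψ : 𝒳 × W → ℂ) (q : 𝒳 → 𝒴 → ℝ) :
    Matrix (𝒴 × (𝒳 × W)) (𝒴 × (𝒳 × W)) ℂ :=
  fun P Q => if P.1 = Q.1 ∧ P.2.1 = Q.2.1
    then (q P.2.1 P.1 : ℂ) * ψ P.2 * star (ψ Q.2) else 0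

/-- The `n`-fold tensor power of a purification vector of a cq state, with the
classical, `B` and `E` registers collected. -/
def vecPowBE {𝒳 B E : Type*} (ψ : 𝒳 × (B × E) → ℂ) (n : ℕ) :
    (Fin n → 𝒳) × ((Fin n → B) × (Fin n → E)) → ℂ :=
  fun xw => ∏ k, ψ (xw.1 k, (xw.2.1 k, xw.2.2 k))

variable {𝒴' 𝒳 B E : Type*} [Fintype 𝒴'] [DecidableEq 𝒴'] [Fintype 𝒳] [DecidableEq 𝒳]
  [Fintype B] [DecidableEq B] [Fintype E] [DecidableEq E]

/-- `I(Y;B)` on a state of the form `τ^{Y(X(BE))}`. -/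
def miYB (τ : Matrix (𝒴' × (𝒳 × (B × E))) (𝒴' × (𝒳 × (B × E))) ℂ) : ℝ :=
  mutualInfo (ptraceRight (Matrix.reindex (exYB 𝒴' 𝒳 B E) (exYB 𝒴' 𝒳 B E) τ))

/-- `I(Y;BE)` on a state of the form `τ^{Y(X(BE))}`. -/
def miYBE (τ : Matrix (𝒴' × (𝒳 × (B × E))) (𝒴' × (𝒳 × (B × E))) ℂ) : ℝ :=
  mutualInfo (ptraceRight (Matrix.reindex (exYW 𝒴' 𝒳 (B × E)) (exYW 𝒴' 𝒳 (B × E)) τ))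

/-- `I(Y;X)` on a state of the form `τ^{Y(X(BE))}`. -/
def miYX (τ : Matrix (𝒴' × (𝒳 × (B × E))) (𝒴' × (𝒳 × (B × E))) ℂ) : ℝ :=
  mutualInfo (ptraceRight (Matrix.reindex (exYX 𝒴' 𝒳 (B × E)) (exYX 𝒴' 𝒳 (B × E)) τ))

/-- A classical channel: entrywise nonnegative with rows summing to one. -/
def IsChannel {X Y : Type*} [Fintype Y] (q : X → Y → ℝ) : Prop :=
  (∀ x y, 0 ≤ q x y) ∧ ∀ x, ∑ y, q x y = 1

/-- `P_n(R) = max_{Y|X^n} { (1/n) I(Y;B^n) : (1/n) I(Y;B^nE^n) ≤ R }` for a cq state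
with purification vector `ψ`. -/
def Pn (ψ : 𝒳 × (B × E) → ℂ) (n : ℕ) (R : ℝ) : ℝ :=
  sSup { v : ℝ | ∃ (m : ℕ) (q : (Fin n → 𝒳) → Fin m → ℝ), IsChannel q ∧
    (1 / n : ℝ) * miYBE (chanState (vecPowBE ψ n) q) ≤ R ∧
    v = (1 / n : ℝ) * miYB (chanState (vecPowBE ψ n) q) }

/-- `D_n(R) = max_{Y|X^n} { (1/n) I(Y;B^n) : (1/n)(I(Y;X^n) - I(Y;B^n)) ≤ R }` for a cq
state with purification vector `ψ`. -/
def Dn (ψ : 𝒳 × (B × E) → ℂ) (n : ℕ) (R : ℝ) : ℝ :=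
  sSup { v : ℝ | ∃ (m : ℕ) (q : (Fin n → 𝒳) → Fin m → ℝ), IsChannel q ∧
    (1 / n : ℝ) * (miYX (chanState (vecPowBE ψ n) q)
      - miYB (chanState (vecPowBE ψ n) q)) ≤ R ∧
    v = (1 / n : ℝ) * miYB (chanState (vecPowBE ψ n) q) }

/-! ### Quantum channels -/

/-- A completely positive trace-preserving map between matrix algebras. -/
structure CPTP (ι κ : Type*) [Fintype ι] [DecidableEq ι] [Fintype κ] [DecidableEq κ] where
  map : Matrix ι ι ℂ →ₗ[ℂ] Matrix κ κ ℂ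
  trace_preserving : ∀ ρ, (map ρ).trace = ρ.trace
  completely_positive : ∀ (n : ℕ) (ρ : Matrix (ι × Fin n) (ι × Fin n) ℂ), ρ.PosSemidef →
    (Matrix.of fun p q : κ × Fin n =>
      map (Matrix.of fun i i' => ρ (i, p.2) (i', q.2)) p.1 q.1).PosSemidef


theorem entropy_eq_sum {ι : Type*} [Fintype ι] [DecidableEq ι] {A : Matrix ι ι ℂ}
    (h : A.IsHermitian) : entropy A = ∑ i, Real.negMulLog (h.eigenvalues i) := by
  unfold entropy
  rw [dif_pos h, ← Finset.sum_neg_distrib]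
  simp [Real.negMulLog]

theorem entropy_eq_roots {ι : Type*} [Fintype ι] [DecidableEq ι] {A : Matrix ι ι ℂ}
    (h : A.IsHermitian) :
    entropy A = (A.charpoly.roots.map (fun z => Real.negMulLog z.re)).sum := by
  rw [entropy_eq_sum h, h.roots_charpoly_eq_eigenvalues, Multiset.map_map]
  rfl

theorem entropy_of_mul {ι κ : Type*} [Fintype ι] [DecidableEq ι] [Fintype κ] [DecidableEq κ]
    {A : Matrix ι ι ℂ} (h : A.IsHermitian) (V : Matrix ι κ ℂ) (W : Matrix κ ι ℂ)
    (d : κ → ℝ) (hA : A = V * W) (hd : W * V = diagonal (fun k => (d k : ℂ))) :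
    entropy A = ∑ k, Real.negMulLog (d k) := by
  rw [entropy_eq_roots h]
  have key := charpoly_mul_comm' V W
  rw [← hA, hd, charpoly_diagonal] at key
  have h1 : (Polynomial.X ^ Fintype.card κ * A.charpoly : Polynomial ℂ) ≠ 0 :=
    mul_ne_zero (pow_ne_zero _ Polynomial.X_ne_zero) (charpoly_monic A).ne_zero
  have h2 := h1
  rw [key] at h2
  have hr := congrArg (fun p : Polynomial ℂ =>
    (p.roots.map (fun z => Real.negMulLog z.re)).sum) key
  simp only [Polynomial.roots_mul h1, Polynomial.roots_mul h2, Multiset.map_add,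
    Multiset.sum_add, Polynomial.roots_X_pow, Multiset.map_nsmul, Multiset.map_singleton,
    Multiset.sum_nsmul, Multiset.sum_singleton, Complex.zero_re, Real.negMulLog_zero,
    smul_zero, zero_add] at hr
  have hp : (∏ i, (Polynomial.X - Polynomial.C (d i : ℂ)) : Polynomial ℂ)
      = ((Finset.univ.val.map (fun i => (d i : ℂ))).map
        (fun a => Polynomial.X - Polynomial.C a)).prod := by
    rw [Multiset.map_map]; rfl
  rw [hr, hp, Polynomial.roots_multiset_prod_X_sub_C, Multiset.map_map]
  rfl

theorem exists_spec {ι : Type*} [Fintype ι] [DecidableEq ι] {A : Matrix ι ι ℂ}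
    (h : A.PosSemidef) : ∃ (V : Matrix ι ι ℂ) (d : ι → ℝ), Vᴴ * V = 1 ∧ V * Vᴴ = 1 ∧
      A = V * diagonal (fun i => (d i : ℂ)) * Vᴴ ∧ (∀ i, 0 ≤ d i) ∧
      entropy A = ∑ i, Real.negMulLog (d i) := by
  refine ⟨h.1.eigenvectorUnitary, h.1.eigenvalues, ?_, ?_, ?_, h.eigenvalues_nonneg,
    entropy_eq_sum h.1⟩
  · exact Unitary.coe_star_mul_self _
  · exact Unitary.coe_mul_star_self _
  · exact h.1.spectral_theorem

theorem entropy_reindex {ι κ : Type*} [Fintype ι] [DecidableEq ι] [Fintype κ] [DecidableEq κ]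
    (e : ι ≃ κ) {A : Matrix ι ι ℂ} (h : A.IsHermitian) :
    entropy (Matrix.reindex e e A) = entropy A := by
  have h' : (Matrix.reindex e e A).IsHermitian := by
    simpa using h.submatrix e.symm
  rw [entropy_eq_roots h, entropy_eq_roots h', charpoly_reindex]

/-- entropy of block-diagonal -/
def bdiag {Y A : Type*} [DecidableEq Y] (τ : Y → Matrix A A ℂ) : Matrix (Y × A) (Y × A) ℂ :=
  fun P Q => if P.1 = Q.1 then τ P.1 P.2 Q.2 else 0

theorem entropy_bdiag {Y A : Type*} [Fintype Y] [DecidableEq Y] [Fintype A] [DecidableEq A]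
    (τ : Y → Matrix A A ℂ) (h : ∀ y, (τ y).PosSemidef) :
    entropy (bdiag τ) = ∑ y, entropy (τ y) := by
  choose V d h1 h2 h3 h4 h5 using fun y => exists_spec (h y)
  have hH : (bdiag τ).IsHermitian := by
    ext ⟨y, a⟩ ⟨y', a'⟩
    simp only [bdiag, conjTranspose_apply]
    by_cases hy : y = y'
    · subst hy
      simpa using congrFun (congrFun (h y).1 a) a'
    · simp [hy, Ne.symm hy]
  have hmul : ∀ f g : Y → Matrix A A ℂ, bdiag f * bdiag g = bdiag (fun y => f y * g y) := by
    intro f g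
    ext ⟨y, a⟩ ⟨y', a'⟩
    simp only [bdiag, Matrix.mul_apply, Fintype.sum_prod_type]
    rw [Finset.sum_eq_single y]
    · by_cases hy : y = y' <;> simp [hy]
    · intro b _ hb; simp [Ne.symm hb]
    · simp
  rw [entropy_of_mul hH (bdiag V) (bdiag fun y => diagonal (fun i => (d y i : ℂ)) * (V y)ᴴ)
    (fun p : Y × A => d p.1 p.2), Fintype.sum_prod_type]
  · simp [h5]
  · rw [hmul]; congr 1; ext1 y; rw [h3 y, mul_assoc]
  · rw [hmul]
    simp only [mul_assoc, h1, mul_one]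
    ext ⟨y, a⟩ ⟨y', a'⟩
    by_cases hy : y = y'
    · subst hy; by_cases ha : a = a' <;> simp [bdiag, diagonal_apply, ha]
    · simp [bdiag, hy, diagonal_apply]

theorem entropy_diag {Y : Type*} [Fintype Y] [DecidableEq Y] (d : Y → ℝ) :
    entropy (diagonal (fun y => (d y : ℂ))) = ∑ y, Real.negMulLog (d y) := by
  refine entropy_of_mul ?_ 1 (diagonal (fun y => (d y : ℂ))) d (by simp) (by simp)
  ext i j
  by_cases hij : i = j
  · subst hij; simp
  · simp [hij, diagonal_apply, Ne.symm hij]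

theorem entropy_kron {A C : Type*} [Fintype A] [DecidableEq A] [Fintype C] [DecidableEq C]
    {α : Matrix A A ℂ} {β : Matrix C C ℂ} (hα : α.PosSemidef) (hβ : β.PosSemidef) :
    entropy (α ⊗ₖ β) = β.trace.re * entropy α + α.trace.re * entropy β := by
  obtain ⟨V, d, h1, h2, h3, h4, h5⟩ := exists_spec hα
  obtain ⟨W, f, k1, k2, k3, k4, k5⟩ := exists_spec hβ
  have ta : α.trace.re = ∑ i, d i := by
    rw [h3, Matrix.trace_mul_comm, ← mul_assoc, h1]; simp
  have tb : β.trace.re = ∑ i, f i := by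
    rw [k3, Matrix.trace_mul_comm, ← mul_assoc, k1]; simp
  rw [entropy_of_mul (hα.kronecker hβ).1 (V ⊗ₖ W)
    ((diagonal (fun i => (d i : ℂ)) * Vᴴ) ⊗ₖ (diagonal (fun i => (f i : ℂ)) * Wᴴ))
    (fun p : A × C => d p.1 * f p.2)]
  · rw [Fintype.sum_prod_type, ta, tb, h5, k5]
    simp only [Real.negMulLog_mul, Finset.sum_add_distrib, ← Finset.mul_sum, ← Finset.sum_mul]
  · rw [← mul_kronecker_mul, ← mul_assoc, ← mul_assoc, ← h3, ← k3]
  · rw [← mul_kronecker_mul, mul_assoc, mul_assoc, h1, k1, mul_one, mul_one,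
      diagonal_kronecker_diagonal]
    simp

theorem entropy_smul {A : Type*} [Fintype A] [DecidableEq A]
    {α : Matrix A A ℂ} (hα : α.PosSemidef) (c : ℝ) (hc : 0 ≤ c) :
    entropy ((c : ℂ) • α) = c * entropy α + α.trace.re * Real.negMulLog c := by
  obtain ⟨V, d, h1, h2, h3, h4, h5⟩ := exists_spec hα
  have ta : α.trace.re = ∑ i, d i := by
    rw [h3, Matrix.trace_mul_comm, ← mul_assoc, h1]; simp
  have hp : ((c : ℂ) • α).PosSemidef := hα.smul (by exact_mod_cast hc)
  rw [entropy_of_mul hp.1 V ((c : ℂ) • (diagonal (fun i => (d i : ℂ)) * Vᴴ))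
    (fun p => c * d p)]
  · rw [ta, h5]
    simp only [Real.negMulLog_mul, Finset.sum_add_distrib, ← Finset.mul_sum, ← Finset.sum_mul]
    ring
  · conv_lhs => rw [h3]
    simp [mul_assoc]
  · rw [smul_mul_assoc, mul_assoc, h1, mul_one, ← diagonal_smul]
    ext i j; simp [diagonal_apply]

/-- block mutual information -/
theorem mutualInfo_bdiag {Y A : Type*} [Fintype Y] [DecidableEq Y] [Fintype A] [DecidableEq A]
    (τ : Y → Matrix A A ℂ) (h : ∀ y, (τ y).PosSemidef) :
    mutualInfo (bdiag τ) = ∑ y, Real.negMulLog (τ y).trace.re + entropy (∑ y, τ y)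
      - ∑ y, entropy (τ y) := by
  unfold mutualInfo
  rw [entropy_bdiag τ h]
  congr 2
  · rw [← entropy_diag]
    congr 1
    ext y y'
    by_cases hy : y = y'
    · subst hy
      have : ((τ y).trace.re : ℂ) = (τ y).trace := by
        have := (h y).trace_nonneg
        rw [Complex.le_def] at this
        apply Complex.ext <;> simp [← this.2]
      rw [diagonal_apply_eq, this]
      simp [ptraceRight, bdiag, Matrix.trace]
    · simp [ptraceRight, bdiag, hy]
  · congr 1
    ext a a'
    simp [ptraceLeft, bdiag, Matrix.sum_apply]


theorem log_compare {I J : Type*} [Fintype I] [Fintype J] (c m : I → ℝ) (d n : J → ℝ)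
    (hm : ∀ i, 0 ≤ m i) (hn : ∀ j, 0 ≤ n j)
    (hmc : ∀ i, m i = 0 → c i = 0) (hnd : ∀ j, n j = 0 → d j = 0)
    (hsum : ∑ i, c i = ∑ j, d j)
    (hres : ∀ t : ℝ, 0 < t → ∑ j, d j / (n j + t) ≤ ∑ i, c i / (m i + t)) :
    ∑ i, c i * Real.log (m i) ≤ ∑ j, d j * Real.log (n j) := by
  set F : ℝ → ℝ := fun t => ∑ j, d j * Real.log (n j + t) - ∑ i, c i * Real.log (m i + t) with hF
  have hder : ∀ t : ℝ, 0 < t →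
      HasDerivAt F (∑ j, d j / (n j + t) - ∑ i, c i / (m i + t)) t := by
    intro t ht
    refine HasDerivAt.sub ?_ ?_
    · refine HasDerivAt.fun_sum fun j _ => ?_
      have h0 : n j + t ≠ 0 := by have := hn j; positivity
      simpa [div_eq_mul_inv] using
        (((hasDerivAt_id t).const_add (n j)).log h0).const_mul (d j)
    · refine HasDerivAt.fun_sum fun j _ => ?_
      have h0 : m j + t ≠ 0 := by have := hm j; positivity
      simpa [div_eq_mul_inv] using
        (((hasDerivAt_id t).const_add (m j)).log h0).const_mul (c j)
  have hanti : AntitoneOn F (Set.Ioi 0) := by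
    apply antitoneOn_of_deriv_nonpos (convex_Ioi 0)
    · exact fun t ht => (hder t ht).continuousAt.continuousWithinAt
    · intro t ht
      rw [interior_Ioi] at ht
      exact (hder t ht).differentiableAt.differentiableWithinAt
    · intro t ht
      rw [interior_Ioi] at ht
      rw [(hder t ht).deriv]
      linarith [hres t ht]
  have hlim1 : ∀ a : ℝ, Tendsto (fun t : ℝ => Real.log (a + t) - Real.log t) atTop (nhds 0) := by
    intro a
    have h1 : Tendsto (fun t : ℝ => a / t + 1) atTop (nhds (0 + 1)) :=
      (tendsto_const_nhds.div_atTop tendsto_id).add_const 1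
    have h2 := (Real.continuousAt_log (by norm_num : (0 + 1 : ℝ) ≠ 0)).tendsto.comp h1
    simp only [zero_add, Real.log_one] at h2
    refine h2.congr' ?_
    filter_upwards [eventually_gt_atTop 0, eventually_gt_atTop (-a)] with t ht hta
    rw [← Real.log_div (by linarith) ht.ne']
    simp only [Function.comp]
    congr 1
    field_simp
  have hlim : Tendsto F atTop (nhds 0) := by
    have : Tendsto (fun t : ℝ => ∑ j, d j * (Real.log (n j + t) - Real.log t)
        - ∑ i, c i * (Real.log (m i + t) - Real.log t)) atTop
        (nhds (∑ j, d j * 0 - ∑ i, c i * 0)) := by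
      refine Tendsto.sub ?_ ?_
      · exact tendsto_finsetSum _ fun j _ => (hlim1 _).const_mul _
      · exact tendsto_finsetSum _ fun j _ => (hlim1 _).const_mul _
    simp only [mul_zero, Finset.sum_const_zero, sub_zero] at this
    refine this.congr fun t => ?_
    simp only [hF, mul_sub, Finset.sum_sub_distrib, ← Finset.sum_mul, hsum]
    ring
  have hpos : ∀ t : ℝ, 0 < t → 0 ≤ F t := by
    intro t ht
    refine le_of_tendsto hlim ?_
    filter_upwards [eventually_ge_atTop t] with s hs
    exact hanti ht (lt_of_lt_of_le ht hs) hs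
  have hz : ∀ a b : ℝ, (a = 0 → b = 0) →
      Tendsto (fun t : ℝ => b * Real.log (a + t)) (nhdsWithin 0 (Set.Ioi 0))
        (nhds (b * Real.log a)) := by
    intro a b hab
    by_cases ha : a = 0
    · simp [hab ha]
    · have h1 : Tendsto (fun t : ℝ => a + t) (nhdsWithin 0 (Set.Ioi 0)) (nhds (a + 0)) :=
        ((continuous_const.add continuous_id).tendsto 0).mono_left nhdsWithin_le_nhds
      rw [add_zero] at h1
      exact (((Real.continuousAt_log ha).tendsto).comp h1).const_mul b
  have hlim0 : Tendsto F (nhdsWithin 0 (Set.Ioi 0))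
      (nhds (∑ j, d j * Real.log (n j) - ∑ i, c i * Real.log (m i))) :=
    (tendsto_finsetSum _ fun j _ => hz _ _ (hnd j)).sub
      (tendsto_finsetSum _ fun i _ => hz _ _ (hmc i))
  have := ge_of_tendsto hlim0 (by
    filter_upwards [self_mem_nhdsWithin] with t ht
    exact hpos t ht)
  linarith


/-- product vector -/
def tv {A C : Type*} (v : A → ℂ) (b : C → ℂ) : A × C → ℂ := fun p => v p.1 * b p.2

theorem parseval {ι : Type*} [Fintype ι] [DecidableEq ι] (E : Matrix ι ι ℂ) (hE : E * Eᴴ = 1)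
    (x y : ι → ℂ) :
    ∑ i, ((starRingEnd ℂ) ((Eᴴ *ᵥ x) i) * (Eᴴ *ᵥ y) i).re = (star x ⬝ᵥ y).re := by
  rw [← Complex.re_sum]
  congr 1
  have : star x ⬝ᵥ y = star (Eᴴ *ᵥ x) ⬝ᵥ (Eᴴ *ᵥ y) := by
    rw [star_mulVec, conjTranspose_conjTranspose, ← dotProduct_mulVec, mulVec_mulVec, hE,
      one_mulVec]
  rw [this]
  rfl

theorem parseval_sq {ι : Type*} [Fintype ι] [DecidableEq ι] (E : Matrix ι ι ℂ) (hE : E * Eᴴ = 1)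
    (x : ι → ℂ) :
    ∑ i, Complex.normSq ((Eᴴ *ᵥ x) i) = ∑ i, Complex.normSq (x i) := by
  have h := parseval E hE x x
  have h2 : ∀ z : ℂ, ((starRingEnd ℂ) z * z).re = Complex.normSq z := by
    intro z; rw [Complex.normSq_apply]; simp
  simp only [h2] at h
  rw [h]
  simp [dotProduct, Complex.normSq_apply]

theorem quad_spec {ι : Type*} [Fintype ι] [DecidableEq ι] (E : Matrix ι ι ℂ) (m : ι → ℝ)
    (x : ι → ℂ) :
    ∑ i, m i * Complex.normSq ((Eᴴ *ᵥ x) i) =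
      (star x ⬝ᵥ ((E * diagonal (fun i => (m i : ℂ)) * Eᴴ) *ᵥ x)).re := by
  have : star x ⬝ᵥ ((E * diagonal (fun i => (m i : ℂ)) * Eᴴ) *ᵥ x)
      = star (Eᴴ *ᵥ x) ⬝ᵥ (diagonal (fun i => (m i : ℂ)) *ᵥ (Eᴴ *ᵥ x)) := by
    rw [star_mulVec, conjTranspose_conjTranspose, ← dotProduct_mulVec, mulVec_mulVec,
      mulVec_mulVec, mul_assoc]
  rw [this]
  simp only [dotProduct, mulVec_diagonal, Complex.re_sum]
  refine Finset.sum_congr rfl fun i _ => ?_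
  simp [Complex.normSq_apply]
  ring

theorem tv_dot {A C : Type*} [Fintype A] [Fintype C] (v v' : A → ℂ) (b b' : C → ℂ) :
    star (tv v b) ⬝ᵥ tv v' b' = (star v ⬝ᵥ v') * (star b ⬝ᵥ b') := by
  simp only [dotProduct, tv, Fintype.sum_prod_type, Finset.sum_mul_sum, Pi.star_apply, star_mul']
  refine Finset.sum_congr rfl fun i _ => Finset.sum_congr rfl fun j _ => ?_
  ring

theorem tv_quad {A C : Type*} [Fintype A] [Fintype C] [DecidableEq C]
    (ω : Matrix (A × C) (A × C) ℂ) (W : Matrix C C ℂ) (hW : W * Wᴴ = 1) (v : A → ℂ) :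
    ∑ k, star (tv v (fun c => W c k)) ⬝ᵥ (ω *ᵥ tv v (fun c => W c k))
      = star v ⬝ᵥ (ptraceRight ω *ᵥ v) := by
  have hW' : ∀ c c', ∑ k, W c' k * star (W c k) = if c' = c then 1 else 0 := by
    intro c c'
    have := congrFun (congrFun hW c') c
    simpa [Matrix.mul_apply, Matrix.one_apply] using this
  simp only [dotProduct, mulVec, tv, Fintype.sum_prod_type, Pi.star_apply, star_mul', ptraceRight]
  rw [Finset.sum_comm]
  refine Finset.sum_congr rfl fun x _ => ?_
  rw [Finset.sum_comm]
  have : ∀ c : C, ∑ k, star (v x) * star (W c k) * ∑ x', ∑ c', ω (x, c) (x', c') * (v x' * W c' k)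
      = star (v x) * ∑ x', ω (x, c) (x', c) * v x' := by
    intro c
    simp only [Finset.mul_sum]
    rw [Finset.sum_comm]
    refine Finset.sum_congr rfl fun x' _ => ?_
    rw [Finset.sum_comm]
    have h3 : ∀ c', ∑ k, star (v x) * star (W c k) * (ω (x, c) (x', c') * (v x' * W c' k))
        = star (v x) * (ω (x, c) (x', c') * v x') * ∑ k, W c' k * star (W c k) := by
      intro c'
      rw [Finset.mul_sum]
      refine Finset.sum_congr rfl fun k _ => ?_
      ring
    simp only [h3, hW']
    simp
  simp only [this, ← Finset.mul_sum]
  rw [Finset.sum_comm]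
  simp only [Finset.sum_mul]

theorem spec_diag {ι : Type*} [Fintype ι] [DecidableEq ι] (E : Matrix ι ι ℂ) (hE : Eᴴ * E = 1)
    (m : ι → ℝ) {K : Type*} [Fintype K] (c : K → ℝ) (x : K → ι → ℂ)
    (h : ∑ k, (c k : ℂ) • vecMulVec (x k) (star (x k)) = E * diagonal (fun i => (m i : ℂ)) * Eᴴ)
    (i : ι) : ∑ k, c k * Complex.normSq ((Eᴴ *ᵥ x k) i) = m i := by
  have h1 : Eᴴ * (∑ k, (c k : ℂ) • vecMulVec (x k) (star (x k))) * E
      = diagonal (fun i => (m i : ℂ)) := by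
    rw [h, mul_assoc, mul_assoc, mul_assoc, hE, mul_one, ← mul_assoc, hE, one_mul]
  have h2 := congrArg Complex.re (congrFun (congrFun h1 i) i)
  rw [diagonal_apply_eq, Complex.ofReal_re] at h2
  rw [← h2, Finset.mul_sum, Finset.sum_mul, Matrix.sum_apply, Complex.re_sum]
  refine Finset.sum_congr rfl fun k _ => ?_
  rw [mul_smul_comm, smul_mul_assoc, mul_vecMulVec, vecMulVec_mul]
  have : (star (x k)) ᵥ* E = star (Eᴴ *ᵥ x k) := by
    rw [star_mulVec, conjTranspose_conjTranspose]
  rw [this, Matrix.smul_apply, vecMulVec_apply, Pi.star_apply]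
  simp [Complex.normSq_apply]

theorem scalar_var (μ w m t : ℝ) (hμ : 0 ≤ μ) (hw : 0 ≤ w) (hm : 0 ≤ m) (ht : 0 < t) (u z : ℂ) :
    μ * (2 * ((starRingEnd ℂ) u * z).re) - (w * m + t * μ) * Complex.normSq z ≤
      μ * Complex.normSq u / (m * w / μ + t) := by
  rcases hμ.eq_or_lt with h0 | hpos
  · subst h0
    have := Complex.normSq_nonneg z
    simp
    positivity
  · have hl : 0 < m * w / μ + t := by positivity
    rw [le_div_iff₀ hl]
    set l := m * w / μ + t with hldef
    have hml : w * m + t * μ = μ * l := by rw [hldef]; field_simp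
    rw [hml]
    have := Complex.normSq_nonneg (u - (l : ℂ) * z)
    simp only [Complex.normSq_apply, Complex.sub_re, Complex.sub_im, Complex.mul_re,
      Complex.mul_im, Complex.ofReal_re, Complex.ofReal_im, Complex.conj_re,
      Complex.conj_im] at this ⊢
    nlinarith [mul_nonneg hpos.le this]


theorem spec_sum {ι : Type*} [Fintype ι] [DecidableEq ι] (V : Matrix ι ι ℂ) (d : ι → ℝ) :
    V * diagonal (fun i => (d i : ℂ)) * Vᴴ =
      ∑ k, (d k : ℂ) • vecMulVec (fun c => V c k) (star fun c => V c k) := by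
  ext i j
  rw [Matrix.mul_apply, Matrix.sum_apply]
  refine Finset.sum_congr rfl fun k _ => ?_
  simp [vecMulVec_apply]
  ring

theorem unit_col {ι : Type*} [Fintype ι] [DecidableEq ι] (V : Matrix ι ι ℂ) (h : Vᴴ * V = 1)
    (k : ι) : (star fun c => V c k) ⬝ᵥ (fun c => V c k) = 1 := by
  have := congrFun (congrFun h k) k
  simpa [Matrix.mul_apply, dotProduct] using this

theorem ssa_aux {S A C : Type*} [Fintype S] [Fintype A] [DecidableEq A] [Fintype C]
    [DecidableEq C] (a : S → A → ℂ) (β : S → Matrix C C ℂ) (hβ : ∀ s, (β s).PosSemidef)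
    (ω : Matrix (A × C) (A × C) ℂ) (hω : ω.PosSemidef)
    (hωd : ω = ∑ s, vecMulVec (a s) (star (a s)) ⊗ₖ β s)
    (ωA : Matrix A A ℂ) (hωA : ωA.PosSemidef)
    (hωAd : ωA = ∑ s, (((β s).trace.re : ℝ) : ℂ) • vecMulVec (a s) (star (a s))) :
    entropy ωA + ∑ s, (∑ i, Complex.normSq (a s i)) *
      (entropy (β s) - Real.negMulLog (β s).trace.re) ≤ entropy ω := by
  obtain ⟨E, m, hE1, hE2, hE3, hm, hEe⟩ := exists_spec hω
  obtain ⟨F, n, hF1, hF2, hF3, hn, hFe⟩ := exists_spec hωA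
  choose W μ hW1 hW2 hW3 hμ hWe using fun s => exists_spec (hβ s)
  have hw : ∀ s, (β s).trace.re = ∑ k, μ s k := by
    intro s
    rw [hW3 s, Matrix.trace_mul_comm, ← mul_assoc, hW1]; simp
  set w : S → ℝ := fun s => (β s).trace.re with hwdef
  have hw0 : ∀ s, 0 ≤ w s := fun s => by
    simp only [hwdef]; rw [hw s]; exact Finset.sum_nonneg fun k _ => hμ s k
  have hbt : ∀ s, (β s).trace = (w s : ℂ) := by
    intro s
    have := (hβ s).trace_nonneg
    rw [Complex.le_def] at this
    apply Complex.ext <;> simp [hwdef, ← this.2]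
  have hpt : ptraceRight ω = ωA := by
    ext i j
    rw [hωd, hωAd]
    simp only [ptraceRight, Matrix.sum_apply, kroneckerMap_apply, Matrix.smul_apply]
    rw [Finset.sum_comm]
    refine Finset.sum_congr rfl fun s _ => ?_
    rw [← Finset.mul_sum, smul_eq_mul, mul_comm]
    congr 1
    exact hbt s
  have hωsum : ∑ p : S × C, (μ p.1 p.2 : ℂ) • vecMulVec (tv (a p.1) (fun c => W p.1 c p.2))
      (star (tv (a p.1) (fun c => W p.1 c p.2))) = E * diagonal (fun i => (m i : ℂ)) * Eᴴ := by
    rw [← hE3, hωd, Fintype.sum_prod_type]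
    refine Finset.sum_congr rfl fun s _ => ?_
    rw [hW3 s, spec_sum]
    ext ⟨i, c⟩ ⟨j, c'⟩
    simp only [Matrix.sum_apply, kroneckerMap_apply, Matrix.smul_apply, vecMulVec_apply, tv,
      Pi.star_apply, star_mul', Finset.mul_sum, smul_eq_mul]
    refine Finset.sum_congr rfl fun k _ => ?_
    ring
  have hmi := spec_diag E hE1 m (fun p : S × C => μ p.1 p.2) _ hωsum
  rw [hωAd] at hF3
  have hnj := spec_diag F hF1 n w _ hF3
  rw [← hωAd] at hF3
  set u : S → C → A × C → ℂ := fun s k => Eᴴ *ᵥ tv (a s) (fun c => W s c k) with hu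
  set g : S → A → ℂ := fun s => Fᴴ *ᵥ a s with hg
  set c : S × C × (A × C) → ℝ := fun p => μ p.1 p.2.1 * Complex.normSq (u p.1 p.2.1 p.2.2) with hc
  have hc0 : ∀ p, 0 ≤ c p := fun p => mul_nonneg (hμ _ _) (Complex.normSq_nonneg _)
  have hmi' : ∀ i, ∑ s, ∑ k, μ s k * Complex.normSq (u s k i) = m i := by
    intro i
    rw [← hmi i, Fintype.sum_prod_type]
  have hsumi : ∀ s k, ∑ i, Complex.normSq (u s k i) = ∑ i, Complex.normSq (a s i) := by
    intro s k
    rw [hu, parseval_sq E hE2]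
    have h1 : ∀ {ι : Type _} [Fintype ι] (x : ι → ℂ),
        ∑ i, (Complex.normSq (x i) : ℂ) = star x ⬝ᵥ x := by
      intro ι _ x
      refine Finset.sum_congr rfl fun i _ => ?_
      rw [Complex.normSq_eq_conj_mul_self]; rfl
    have h2 := tv_dot (a s) (a s) (fun c => W s c k) (fun c => W s c k)
    rw [unit_col _ (hW1 s), mul_one] at h2
    have h3 : ((∑ i, Complex.normSq (tv (a s) (fun c => W s c k) i) : ℝ) : ℂ)
        = ((∑ i, Complex.normSq (a s i) : ℝ) : ℂ) := by
      have e1 : ∑ i, (Complex.normSq (a s i) : ℂ) = star (a s) ⬝ᵥ a s := by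
        refine Finset.sum_congr rfl fun i _ => ?_
        rw [Complex.normSq_eq_conj_mul_self]; rfl
      push_cast
      rw [h1, h2, e1]
    exact_mod_cast h3
  have hcm : ∀ p, m p.2.2 = 0 → c p = 0 := by
    rintro ⟨s, k, i⟩ h
    have h1 := hmi' i
    simp only at h
    rw [h] at h1
    have h2 := (Finset.sum_eq_zero_iff_of_nonneg (fun s _ => Finset.sum_nonneg
      fun k _ => hc0 (s, k, i))).1 h1 s (Finset.mem_univ _)
    exact (Finset.sum_eq_zero_iff_of_nonneg (fun k _ => hc0 (s, k, i))).1 h2 k (Finset.mem_univ _)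
  have hcμ : ∀ p, μ p.1 p.2.1 = 0 → c p = 0 := by
    intro p h
    simp [hc, h]
  have hcw : ∀ p, w p.1 = 0 → c p = 0 := by
    intro p h
    refine hcμ p ?_
    have h1 : ∑ k, μ p.1 k = 0 := by rw [← hw]; exact h
    exact (Finset.sum_eq_zero_iff_of_nonneg (fun k _ => hμ p.1 k)).1 h1 _ (Finset.mem_univ _)
  have hsum3 : ∀ f : S × C × (A × C) → ℝ, ∑ p, f p = ∑ s, ∑ k, ∑ i, f (s, k, i) := by
    intro f
    rw [Fintype.sum_prod_type]
    refine Finset.sum_congr rfl fun s _ => ?_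
    rw [Fintype.sum_prod_type]
  have hsum3' : ∀ f : S × C × (A × C) → ℝ, ∑ p, f p = ∑ i, ∑ s, ∑ k, f (s, k, i) := by
    intro f
    rw [hsum3, Finset.sum_comm]
    simp_rw [Finset.sum_comm (s := (Finset.univ : Finset S))]
    rw [Finset.sum_comm]
  have main := log_compare c (fun p => m p.2.2 * w p.1 / μ p.1 p.2.1) n n
    (fun p => div_nonneg (mul_nonneg (hm _) (hw0 _)) (hμ _ _)) hn ?_ (fun j h => h) ?_ ?_
  · -- conclude
    have hterm : ∀ p, c p * Real.log (m p.2.2 * w p.1 / μ p.1 p.2.1) =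
        c p * Real.log (m p.2.2) + c p * Real.log (w p.1) - c p * Real.log (μ p.1 p.2.1) := by
      intro p
      by_cases h : c p = 0
      · simp [h]
      · have h1 := mt (hcm p) h
        have h2 := mt (hcμ p) h
        have h3 := mt (hcw p) h
        rw [Real.log_div (mul_ne_zero h1 h3) h2, Real.log_mul h1 h3]
        ring
    rw [Finset.sum_congr rfl fun p _ => hterm p] at main
    rw [Finset.sum_sub_distrib, Finset.sum_add_distrib] at main
    have e1 : ∑ p, c p * Real.log (m p.2.2) = - entropy ω := by
      rw [hEe, ← Finset.sum_neg_distrib, hsum3']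
      refine Finset.sum_congr rfl fun i _ => ?_
      simp only [hc, ← Finset.sum_mul]
      rw [hmi']
      simp [Real.negMulLog]
    have e2 : ∑ p, c p * Real.log (w p.1) =
        - ∑ s, (∑ i, Complex.normSq (a s i)) * Real.negMulLog (w s) := by
      rw [← Finset.sum_neg_distrib, hsum3]
      refine Finset.sum_congr rfl fun s _ => ?_
      simp only [hc, ← Finset.sum_mul, ← Finset.mul_sum, hsumi]
      rw [← hw]
      simp only [Real.negMulLog, hwdef]
      ring
    have e3 : ∑ p, c p * Real.log (μ p.1 p.2.1) =
        - ∑ s, (∑ i, Complex.normSq (a s i)) * entropy (β s) := by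
      rw [← Finset.sum_neg_distrib, hsum3]
      refine Finset.sum_congr rfl fun s _ => ?_
      rw [hWe, Finset.mul_sum, ← Finset.sum_neg_distrib]
      refine Finset.sum_congr rfl fun k _ => ?_
      simp only [hc, ← Finset.sum_mul, ← Finset.mul_sum, hsumi]
      simp only [Real.negMulLog]
      ring
    have e4 : ∑ j, n j * Real.log (n j) = - entropy ωA := by
      rw [hFe, ← Finset.sum_neg_distrib]
      simp [Real.negMulLog]
    rw [e1, e2, e3, e4] at main
    simp only [mul_sub, Finset.sum_sub_distrib]
    linarith
  · intro p h
    rcases div_eq_zero_iff.1 h with h | h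
    · rcases mul_eq_zero.1 h with h | h
      · exact hcm p h
      · exact hcw p h
    · exact hcμ p h
  · rw [hsum3]
    have h1 : ∀ s, ∑ j, Complex.normSq (g s j) = ∑ i, Complex.normSq (a s i) := fun s =>
      parseval_sq F hF2 _
    have h2 : ∑ j, n j = ∑ s, w s * ∑ i, Complex.normSq (a s i) := by
      simp only [← h1, Finset.mul_sum]
      rw [Finset.sum_comm]
      exact Finset.sum_congr rfl fun j _ => (hnj j).symm
    rw [h2]
    refine Finset.sum_congr rfl fun s _ => ?_
    simp only [hc, ← Finset.mul_sum, hsumi]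
    rw [← Finset.sum_mul, ← hw]
  · intro t ht
    have hnt : ∀ j, n j + t ≠ 0 := fun j => by have := hn j; positivity
    have hL : ∑ j, n j / (n j + t) = ∑ s, w s * ∑ j, Complex.normSq (g s j) / (n j + t) := by
      simp only [Finset.mul_sum]
      rw [Finset.sum_comm]
      refine Finset.sum_congr rfl fun j _ => ?_
      have h5 : ∑ s, w s * Complex.normSq (g s j) = n j := hnj j
      simp only [← mul_div_assoc, ← Finset.sum_div]
      rw [h5]
    rw [hL, hsum3]
    refine Finset.sum_le_sum fun s _ => ?_
    set v : A → ℂ := F *ᵥ (fun j => g s j / ((n j + t : ℝ) : ℂ)) with hv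
    have hFv : Fᴴ *ᵥ v = fun j => g s j / ((n j + t : ℝ) : ℂ) := by
      rw [hv, mulVec_mulVec, hF1, one_mulVec]
    have q1 : (star (a s) ⬝ᵥ v).re = ∑ j, Complex.normSq (g s j) / (n j + t) := by
      rw [← parseval F hF2, hFv]
      refine Finset.sum_congr rfl fun j _ => ?_
      rw [← mul_div_assoc, ← Complex.normSq_eq_conj_mul_self, Complex.div_ofReal_re,
        Complex.ofReal_re]
    have q2 : ∑ i, Complex.normSq (v i) = ∑ j, Complex.normSq (g s j) / (n j + t) ^ 2 := by
      rw [← parseval_sq F hF2, hFv]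
      refine Finset.sum_congr rfl fun j _ => ?_
      rw [Complex.normSq_div, Complex.normSq_ofReal, sq]
    have q3 : (star v ⬝ᵥ (ωA *ᵥ v)).re = ∑ j, n j * (Complex.normSq (g s j) / (n j + t) ^ 2) := by
      rw [hF3, ← quad_spec, hFv]
      refine Finset.sum_congr rfl fun j _ => ?_
      rw [Complex.normSq_div, Complex.normSq_ofReal, sq]
    have hone : ∀ k, ∑ i, Complex.normSq ((Eᴴ *ᵥ tv v (fun c => W s c k)) i)
        = ∑ i, Complex.normSq (v i) := by
      intro k
      have z1 : ∀ z : ℂ, ((starRingEnd ℂ) z * z).re = Complex.normSq z := by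
        intro z; rw [Complex.normSq_apply]; simp
      have := parseval E hE2 (tv v (fun c => W s c k)) (tv v (fun c => W s c k))
      rw [tv_dot, unit_col _ (hW1 s), mul_one] at this
      simp only [z1] at this
      rw [this]
      simp [dotProduct, Complex.normSq_apply]
    have hcross : ∀ k, ∑ i, ((starRingEnd ℂ) (u s k i) *
        (Eᴴ *ᵥ tv v (fun c => W s c k)) i).re = (star (a s) ⬝ᵥ v).re := by
      intro k
      rw [hu, parseval E hE2, tv_dot, unit_col _ (hW1 s), mul_one]
    have hquad : ∑ k, ∑ i, m i * Complex.normSq ((Eᴴ *ᵥ tv v (fun c => W s c k)) i)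
        = (star v ⬝ᵥ (ωA *ᵥ v)).re := by
      rw [← hpt, ← tv_quad ω (W s) (hW2 s) v, Complex.re_sum]
      refine Finset.sum_congr rfl fun k _ => ?_
      rw [quad_spec, ← hE3]
    calc w s * ∑ j, Complex.normSq (g s j) / (n j + t)
        = w s * (2 * (star (a s) ⬝ᵥ v).re) - w s * (star v ⬝ᵥ (ωA *ᵥ v)).re
          - t * w s * ∑ i, Complex.normSq (v i) := by
          rw [q1, q2, q3]
          simp only [Finset.mul_sum, ← Finset.sum_sub_distrib]
          refine Finset.sum_congr rfl fun j _ => ?_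
          have := hnt j
          field_simp
          ring
      _ = ∑ k, ∑ i, (μ s k * (2 * ((starRingEnd ℂ) (u s k i) *
            (Eᴴ *ᵥ tv v (fun c => W s c k)) i).re) - (w s * m i + t * μ s k) *
            Complex.normSq ((Eᴴ *ᵥ tv v (fun c => W s c k)) i)) := by
          have hk : ∀ k, ∑ i, (μ s k * (2 * ((starRingEnd ℂ) (u s k i) *
            (Eᴴ *ᵥ tv v (fun c => W s c k)) i).re) - (w s * m i + t * μ s k) *
            Complex.normSq ((Eᴴ *ᵥ tv v (fun c => W s c k)) i))
            = μ s k * (2 * (star (a s) ⬝ᵥ v).re) - w s *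
              (∑ i, m i * Complex.normSq ((Eᴴ *ᵥ tv v (fun c => W s c k)) i))
              - t * μ s k * ∑ i, Complex.normSq (v i) := by
            intro k
            rw [← hcross k, ← hone k]
            simp only [Finset.mul_sum, ← Finset.sum_sub_distrib]
            refine Finset.sum_congr rfl fun i _ => ?_
            ring
          simp only [hk, Finset.sum_sub_distrib]
          rw [← Finset.mul_sum, hquad, ← Finset.sum_mul, ← hw, ← Finset.sum_mul, ← Finset.mul_sum,
            ← hw]
      _ ≤ _ := by
          refine Finset.sum_le_sum fun k _ => Finset.sum_le_sum fun i _ => ?_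
          exact scalar_var _ _ _ _ (hμ s k) (hw0 s) (hm i) ht _ _


theorem psd_trace {A : Type*} [Fintype A] {α : Matrix A A ℂ} (h : α.PosSemidef) :
    ((α.trace.re : ℝ) : ℂ) = α.trace := by
  have := h.trace_nonneg
  rw [Complex.le_def] at this
  apply Complex.ext <;> simp [← this.2]

theorem ssa {S A C : Type*} [Fintype S] [Fintype A] [DecidableEq A] [Fintype C]
    [DecidableEq C] (α : S → Matrix A A ℂ) (hα : ∀ s, (α s).PosSemidef)
    (β : S → Matrix C C ℂ) (hβ : ∀ s, (β s).PosSemidef) :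
    entropy (∑ s, (((β s).trace.re : ℝ) : ℂ) • α s) + ∑ s, (α s).trace.re *
      (entropy (β s) - Real.negMulLog (β s).trace.re) ≤ entropy (∑ s, α s ⊗ₖ β s) := by
  choose V d h1 h2 h3 h4 h5 using fun s => exists_spec (hα s)
  set a : S × A → A → ℂ := fun p i => (Real.sqrt (d p.1 p.2) : ℂ) * V p.1 i p.2 with ha
  have hsum : ∀ s, ∑ k, vecMulVec (a (s, k)) (star (a (s, k))) = α s := by
    intro s
    conv_rhs => rw [h3 s, spec_sum]
    refine Finset.sum_congr rfl fun k _ => ?_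
    ext i j
    simp only [vecMulVec_apply, ha, Pi.star_apply, star_mul', Matrix.smul_apply, smul_eq_mul]
    have : (Real.sqrt (d s k) : ℂ) * (Real.sqrt (d s k) : ℂ) = d s k := by
      rw [← Complex.ofReal_mul, Real.mul_self_sqrt (h4 s k)]
    rw [← this]
    simp only [RCLike.star_def, Complex.conj_ofReal]
    ring
  have htr : ∀ s, ∑ k, ∑ i, Complex.normSq (a (s, k) i) = (α s).trace.re := by
    intro s
    rw [← hsum s, Matrix.trace_sum, Complex.re_sum]
    refine Finset.sum_congr rfl fun k _ => ?_
    rw [Matrix.trace, Complex.re_sum]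
    refine Finset.sum_congr rfl fun i _ => ?_
    simp [vecMulVec_apply, Complex.normSq_apply]
  have hb : ∀ s, (0 : ℂ) ≤ (((β s).trace.re : ℝ) : ℂ) := by
    intro s; rw [psd_trace (hβ s)]; exact (hβ s).trace_nonneg
  have key := ssa_aux a (fun p => β p.1) (fun p => hβ p.1) (∑ s, α s ⊗ₖ β s)
    (posSemidef_sum _ fun s _ => (hα s).kronecker (hβ s)) ?_
    (∑ s, (((β s).trace.re : ℝ) : ℂ) • α s)
    (posSemidef_sum _ fun s _ => (hα s).smul (hb s)) ?_
  · refine le_trans (le_of_eq ?_) key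
    congr 1
    rw [Fintype.sum_prod_type]
    refine Finset.sum_congr rfl fun s _ => ?_
    rw [← htr s, Finset.sum_mul]
  · rw [Fintype.sum_prod_type]
    refine Finset.sum_congr rfl fun s _ => ?_
    conv_lhs => rw [← hsum s]
    ext ⟨i, c⟩ ⟨j, c'⟩
    simp only [Matrix.sum_apply, kroneckerMap_apply, Finset.sum_mul]
  · rw [Fintype.sum_prod_type]
    refine Finset.sum_congr rfl fun s _ => ?_
    conv_lhs => rw [← hsum s]
    rw [Finset.smul_sum]

/-- mixture with weights -/
def blk {X A : Type*} [Fintype X] (ρ : X → Matrix A A ℂ) (k : X → ℝ) : Matrix A A ℂ :=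
  ∑ x, (k x : ℂ) • ρ x

/-- conditional entropy of quantum part -/
def cB {X A Y : Type*} [Fintype X] [Fintype A] [DecidableEq A] [Fintype Y] (P : X → ℝ)
    (ρ : X → Matrix A A ℂ) (q : X → Y → ℝ) : ℝ :=
  ∑ y, (entropy (blk ρ (fun x => q x y)) - Real.negMulLog (∑ x, q x y * P x))

/-- conditional entropy of classical part -/
def cX {X Y : Type*} [Fintype X] [Fintype Y] (P : X → ℝ) (q : X → Y → ℝ) : ℝ :=
  ∑ y, (∑ x, Real.negMulLog (q x y * P x) - Real.negMulLog (∑ x, q x y * P x))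

/-- ensemble -/
def Ens {X A : Type*} [Fintype A] (P : X → ℝ) (ρ : X → Matrix A A ℂ) : Prop :=
  ∀ x, 0 ≤ P x ∧ (ρ x).PosSemidef ∧ (ρ x).trace = P x

theorem blk_psd {X A : Type*} [Fintype X] [Fintype A] {P : X → ℝ} {ρ : X → Matrix A A ℂ}
    (h : Ens P ρ) (k : X → ℝ) (hk : ∀ x, 0 ≤ k x) : (blk ρ k).PosSemidef :=
  posSemidef_sum _ fun x _ => (h x).2.1.smul (by exact_mod_cast hk x)

theorem blk_trace {X A : Type*} [Fintype X] [Fintype A] {P : X → ℝ} {ρ : X → Matrix A A ℂ}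
    (h : Ens P ρ) (k : X → ℝ) : (blk ρ k).trace = ((∑ x, k x * P x : ℝ) : ℂ) := by
  rw [blk, Matrix.trace_sum]
  push_cast
  exact Finset.sum_congr rfl fun x _ => by rw [Matrix.trace_smul, (h x).2.2, smul_eq_mul]

theorem blk_trace_re {X A : Type*} [Fintype X] [Fintype A] {P : X → ℝ} {ρ : X → Matrix A A ℂ}
    (h : Ens P ρ) (k : X → ℝ) : (blk ρ k).trace.re = ∑ x, k x * P x := by
  rw [blk_trace h, Complex.ofReal_re]

section prod
variable {X₁ X₂ A₁ A₂ Y : Type*} [Fintype X₁] [Fintype X₂] [Fintype A₁] [DecidableEq A₁]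
  [Fintype A₂] [DecidableEq A₂] [Fintype Y] {P₁ : X₁ → ℝ} {P₂ : X₂ → ℝ}
  {ρ₁ : X₁ → Matrix A₁ A₁ ℂ} {ρ₂ : X₂ → Matrix A₂ A₂ ℂ}

/-- product prob -/
def pP (P₁ : X₁ → ℝ) (P₂ : X₂ → ℝ) : X₁ × X₂ → ℝ := fun p => P₁ p.1 * P₂ p.2

/-- product states -/
def pρ (ρ₁ : X₁ → Matrix A₁ A₁ ℂ) (ρ₂ : X₂ → Matrix A₂ A₂ ℂ) :
    X₁ × X₂ → Matrix (A₁ × A₂) (A₁ × A₂) ℂ := fun p => ρ₁ p.1 ⊗ₖ ρ₂ p.2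

theorem Ens.prod (h₁ : Ens P₁ ρ₁) (h₂ : Ens P₂ ρ₂) : Ens (pP P₁ P₂) (pρ ρ₁ ρ₂) := by
  intro p
  refine ⟨mul_nonneg (h₁ _).1 (h₂ _).1, (h₁ _).2.1.kronecker (h₂ _).2.1, ?_⟩
  simp [pρ, pP, trace_kronecker, (h₁ _).2.2, (h₂ _).2.2]

/-- marginal channel -/
def margQ (P₂ : X₂ → ℝ) (q : X₁ × X₂ → Y → ℝ) : X₁ → Y → ℝ :=
  fun x y => ∑ x₂, q (x, x₂) y * P₂ x₂

/-- conditional channel -/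
def condQ (P₁ : X₁ → ℝ) (q : X₁ × X₂ → Y → ℝ) : X₂ → Y × X₁ → ℝ :=
  fun x u => P₁ u.2 * q (u.2, x) u.1

theorem marg_sum (q : X₁ × X₂ → Y → ℝ) (y : Y) :
    ∑ x, q x y * pP P₁ P₂ x = ∑ x, margQ P₂ q x y * P₁ x := by
  simp only [Fintype.sum_prod_type, margQ, pP, Finset.sum_mul]
  refine Finset.sum_congr rfl fun x _ => Finset.sum_congr rfl fun x' _ => ?_
  ring

theorem cX_step (q : X₁ × X₂ → Y → ℝ) :
    cX P₁ (margQ P₂ q) + cX P₂ (condQ P₁ q) = cX (pP P₁ P₂) q := by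
  simp only [cX]
  rw [Fintype.sum_prod_type, ← Finset.sum_add_distrib]
  refine Finset.sum_congr rfl fun y _ => ?_
  rw [marg_sum, Fintype.sum_prod_type, Finset.sum_sub_distrib]
  have h1 : ∀ x, ∑ x', condQ P₁ q x' (y, x) * P₂ x' = margQ P₂ q x y * P₁ x := by
    intro x
    simp only [condQ, margQ, Finset.sum_mul]
    exact Finset.sum_congr rfl fun x' _ => by ring
  have h2 : ∀ x x', condQ P₁ q x' (y, x) * P₂ x' = q (x, x') y * pP P₁ P₂ (x, x') := by
    intro x x'
    simp only [condQ, pP]; ring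
  simp only [h1]
  simp only [h2]
  ring

theorem cB_step (h₁ : Ens P₁ ρ₁) (h₂ : Ens P₂ ρ₂) (q : X₁ × X₂ → Y → ℝ) (hq : ∀ x y, 0 ≤ q x y) :
    cB P₁ ρ₁ (margQ P₂ q) + cB P₂ ρ₂ (condQ P₁ q) ≤ cB (pP P₁ P₂) (pρ ρ₁ ρ₂) q := by
  simp only [cB]
  rw [Fintype.sum_prod_type, ← Finset.sum_add_distrib]
  refine Finset.sum_le_sum fun y _ => ?_
  rw [marg_sum]
  set β : X₁ → Matrix A₂ A₂ ℂ := fun x => blk ρ₂ (fun x' => q (x, x') y) with hβ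
  have hβp : ∀ x, (β x).PosSemidef := fun x => blk_psd h₂ _ fun x' => hq _ _
  have hβt : ∀ x, (β x).trace.re = margQ P₂ q x y := fun x => blk_trace_re h₂ _
  have key := ssa ρ₁ (fun x => (h₁ x).2.1) β hβp
  have e1 : ∑ x, (((β x).trace.re : ℝ) : ℂ) • ρ₁ x = blk ρ₁ (fun x => margQ P₂ q x y) := by
    simp only [hβt, blk]
  have e2 : ∑ x, ρ₁ x ⊗ₖ β x = blk (pρ ρ₁ ρ₂) (fun x => q x y) := by
    simp only [blk, Fintype.sum_prod_type, hβ, pρ]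
    refine Finset.sum_congr rfl fun x _ => ?_
    ext ⟨i, c⟩ ⟨j, c'⟩
    simp only [Matrix.sum_apply, kroneckerMap_apply, Matrix.smul_apply, Finset.mul_sum,
      smul_eq_mul]
    exact Finset.sum_congr rfl fun x' _ => by ring
  have e3 : ∀ x, entropy (blk ρ₂ (fun x' => condQ P₁ q x' (y, x))) -
      Real.negMulLog (∑ x', condQ P₁ q x' (y, x) * P₂ x') =
      (ρ₁ x).trace.re * (entropy (β x) - Real.negMulLog (β x).trace.re) := by
    intro x
    have a1 : blk ρ₂ (fun x' => condQ P₁ q x' (y, x)) = (P₁ x : ℂ) • β x := by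
      simp only [blk, hβ, condQ, Finset.smul_sum, smul_smul, Complex.ofReal_mul]
    have a2 : ∑ x', condQ P₁ q x' (y, x) * P₂ x' = P₁ x * (β x).trace.re := by
      simp only [condQ, hβt, margQ, Finset.mul_sum, mul_assoc]
    rw [a1, a2, entropy_smul (hβp x) _ (h₁ x).1, Real.negMulLog_mul, (h₁ x).2.2,
      Complex.ofReal_re]
    ring
  simp only [e3]
  rw [e1, e2] at key
  linarith

theorem cB_prod {Y' : Type*} [Fintype Y'] (h₁ : Ens P₁ ρ₁) (h₂ : Ens P₂ ρ₂) (hP₁ : ∑ x, P₁ x = 1)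
    (hP₂ : ∑ x, P₂ x = 1) (q : X₁ → Y → ℝ) (q' : X₂ → Y' → ℝ)
    (hq : IsChannel q) (hq' : IsChannel q') :
    cB (pP P₁ P₂) (pρ ρ₁ ρ₂) (fun x (y : Y × Y') => q x.1 y.1 * q' x.2 y.2)
      = cB P₁ ρ₁ q + cB P₂ ρ₂ q' ∧
    cX (pP P₁ P₂) (fun x (y : Y × Y') => q x.1 y.1 * q' x.2 y.2)
      = cX P₁ q + cX P₂ q' := by
  have t1 : ∑ y, ∑ x, q x y * P₁ x = 1 := by
    rw [Finset.sum_comm]; simp only [← Finset.sum_mul, hq.2, one_mul, hP₁]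
  have t2 : ∑ y, ∑ x, q' x y * P₂ x = 1 := by
    rw [Finset.sum_comm]; simp only [← Finset.sum_mul, hq'.2, one_mul, hP₂]
  have hs : ∀ y y', ∑ x, q (Prod.fst x) y * q' (Prod.snd x) y' * pP P₁ P₂ x =
      (∑ x, q x y * P₁ x) * (∑ x, q' x y' * P₂ x) := by
    intro y y'
    rw [Finset.sum_mul_sum, Fintype.sum_prod_type]
    exact Finset.sum_congr rfl fun x _ => Finset.sum_congr rfl fun x' _ => by
      simp only [pP]; ring
  have comb : ∀ (f : Y → ℝ) (f' : Y' → ℝ),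
      ∑ p : Y × Y', ((∑ x, q' x p.2 * P₂ x) * f p.1 + (∑ x, q x p.1 * P₁ x) * f' p.2)
        = ∑ y, f y + ∑ y, f' y := by
    intro f f'
    rw [Finset.sum_add_distrib, Fintype.sum_prod_type, Fintype.sum_prod_type]
    simp only [← Finset.sum_mul, ← Finset.mul_sum, t1, t2, one_mul]
  constructor
  · simp only [cB]
    rw [← comb]
    refine Finset.sum_congr rfl fun p _ => ?_
    have e : blk (pρ ρ₁ ρ₂) (fun x => q x.1 p.1 * q' x.2 p.2)
        = blk ρ₁ (fun x => q x p.1) ⊗ₖ blk ρ₂ (fun x => q' x p.2) := by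
      simp only [blk, pρ]
      ext ⟨i, c⟩ ⟨j, c'⟩
      simp only [Matrix.sum_apply, kroneckerMap_apply, Matrix.smul_apply, Finset.sum_mul_sum,
        smul_eq_mul, Fintype.sum_prod_type, Complex.ofReal_mul]
      exact Finset.sum_congr rfl fun x _ => Finset.sum_congr rfl fun x' _ => by ring
    rw [e, entropy_kron (blk_psd h₁ _ fun x => hq.1 _ _) (blk_psd h₂ _ fun x => hq'.1 _ _),
      blk_trace_re h₁, blk_trace_re h₂, hs, Real.negMulLog_mul]
    ring
  · simp only [cX]
    rw [← comb]
    refine Finset.sum_congr rfl fun p _ => ?_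
    have e : ∑ x, Real.negMulLog (q (Prod.fst x) p.1 * q' (Prod.snd x) p.2 * pP P₁ P₂ x)
        = (∑ x, q' x p.2 * P₂ x) * (∑ x, Real.negMulLog (q x p.1 * P₁ x))
        + (∑ x, q x p.1 * P₁ x) * (∑ x, Real.negMulLog (q' x p.2 * P₂ x)) := by
      rw [Finset.sum_mul_sum, Finset.sum_mul_sum, Finset.sum_comm, ← Finset.sum_add_distrib,
        Fintype.sum_prod_type]
      refine Finset.sum_congr rfl fun x _ => ?_
      rw [← Finset.sum_add_distrib]
      refine Finset.sum_congr rfl fun x' _ => ?_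
      have : q x p.1 * q' x' p.2 * pP P₁ P₂ (x, x') = (q x p.1 * P₁ x) * (q' x' p.2 * P₂ x') := by
        simp only [pP]; ring
      simp only [this, Real.negMulLog_mul]
    rw [e, hs, Real.negMulLog_mul]
    ring

end prod


theorem cB_equiv {X X' A A' Y Y' : Type*} [Fintype X] [Fintype X'] [Fintype A] [DecidableEq A]
    [Fintype A'] [DecidableEq A'] [Fintype Y] [Fintype Y'] (eX : X ≃ X') (eA : A ≃ A')
    (eY : Y ≃ Y') {P : X → ℝ} {P' : X' → ℝ} {ρ : X → Matrix A A ℂ} {ρ' : X' → Matrix A' A' ℂ}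
    {q : X → Y → ℝ} {q' : X' → Y' → ℝ} (h : Ens P ρ) (hq : ∀ x y, 0 ≤ q x y)
    (hP : ∀ x, P' (eX x) = P x) (hρ : ∀ x, ρ' (eX x) = Matrix.reindex eA eA (ρ x))
    (hqq : ∀ x y, q' (eX x) (eY y) = q x y) :
    cB P' ρ' q' = cB P ρ q ∧ cX P' q' = cX P q := by
  constructor
  · simp only [cB]
    rw [← Equiv.sum_comp eY]
    refine Finset.sum_congr rfl fun y _ => ?_
    have e1 : blk ρ' (fun x => q' x (eY y)) = Matrix.reindex eA eA (blk ρ (fun x => q x y)) := by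
      simp only [blk]
      rw [← Equiv.sum_comp eX]
      ext i j
      simp [hρ, hqq, Matrix.sum_apply]
    rw [e1, entropy_reindex eA (blk_psd h _ fun x => hq x y).1, ← Equiv.sum_comp eX]
    simp only [hqq, hP]
  · simp only [cX]
    rw [← Equiv.sum_comp eY]
    refine Finset.sum_congr rfl fun y _ => ?_
    rw [← Equiv.sum_comp eX, ← Equiv.sum_comp eX]
    simp only [hqq, hP]

theorem c_sum {X A Y Y' : Type*} [Fintype X] [Fintype A] [DecidableEq A] [Fintype Y] [Fintype Y']
    (P : X → ℝ) (ρ : X → Matrix A A ℂ) (q : X → Y → ℝ) (q' : X → Y' → ℝ) :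
    cB P ρ (fun x => Sum.elim (q x) (q' x)) = cB P ρ q + cB P ρ q' ∧
    cX P (fun x => Sum.elim (q x) (q' x)) = cX P q + cX P q' := by
  simp only [cB, cX, Fintype.sum_sum_type, Sum.elim_inl, Sum.elim_inr, and_self]

theorem c_smul {X A Y : Type*} [Fintype X] [Fintype A] [DecidableEq A] [Fintype Y]
    {P : X → ℝ} {ρ : X → Matrix A A ℂ} {q : X → Y → ℝ} (h : Ens P ρ) (hq : ∀ x y, 0 ≤ q x y)
    (c : ℝ) (hc : 0 ≤ c) :
    cB P ρ (fun x y => c * q x y) = c * cB P ρ q ∧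
    cX P (fun x y => c * q x y) = c * cX P q := by
  have hs : ∀ y, ∑ x, c * q x y * P x = c * ∑ x, q x y * P x := fun y => by
    rw [Finset.mul_sum]; exact Finset.sum_congr rfl fun x _ => by ring
  constructor
  · simp only [cB]
    rw [Finset.mul_sum]
    refine Finset.sum_congr rfl fun y _ => ?_
    have e1 : blk ρ (fun x => c * q x y) = (c : ℂ) • blk ρ (fun x => q x y) := by
      simp only [blk, Finset.smul_sum, smul_smul, Complex.ofReal_mul]
    rw [e1, entropy_smul (blk_psd h _ fun x => hq x y) c hc, blk_trace_re h, hs,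
      Real.negMulLog_mul]
    ring
  · simp only [cX]
    rw [Finset.mul_sum]
    refine Finset.sum_congr rfl fun y _ => ?_
    rw [hs, Real.negMulLog_mul]
    have : ∀ x, Real.negMulLog (c * q x y * P x) =
        q x y * P x * Real.negMulLog c + c * Real.negMulLog (q x y * P x) := fun x => by
      rw [mul_assoc, Real.negMulLog_mul]
    simp only [this]
    rw [Finset.sum_add_distrib, ← Finset.sum_mul, ← Finset.mul_sum]
    ring

/-- tensor power prob -/
def tP {X : Type*} (P : X → ℝ) (n : ℕ) : (Fin n → X) → ℝ := fun x => ∏ k, P (x k)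

/-- tensor power states -/
def tρ {X A : Type*} (ρ : X → Matrix A A ℂ) (n : ℕ) :
    (Fin n → X) → Matrix (Fin n → A) (Fin n → A) ℂ :=
  fun x a b => ∏ k, ρ (x k) (a k) (b k)

/-- tensor power channel -/
def tq {X Y : Type*} (q : X → Y → ℝ) (n : ℕ) : (Fin n → X) → (Fin n → Y) → ℝ :=
  fun x y => ∏ k, q (x k) (y k)

/-- split off one coordinate -/
def eS (X : Type*) (n : ℕ) : (Fin n → X) × X ≃ (Fin (n + 1) → X) :=
  (Equiv.prodComm _ _).trans (Fin.consEquiv fun _ => X)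

theorem eS_zero {X : Type*} {n : ℕ} (x : (Fin n → X) × X) : eS X n x 0 = x.2 := rfl
theorem eS_succ {X : Type*} {n : ℕ} (x : (Fin n → X) × X) (k : Fin n) :
    eS X n x k.succ = x.1 k := rfl

theorem tP_succ {X : Type*} (P : X → ℝ) (n : ℕ) (x : (Fin n → X) × X) :
    tP P (n + 1) (eS X n x) = pP (tP P n) P x := by
  simp only [tP, pP, Fin.prod_univ_succ, eS_zero, eS_succ]
  ring

theorem tρ_succ {X A : Type*} (ρ : X → Matrix A A ℂ) (n : ℕ) (x : (Fin n → X) × X) :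
    tρ ρ (n + 1) (eS X n x) = Matrix.reindex (eS A n) (eS A n) (pρ (tρ ρ n) ρ x) := by
  ext a b
  obtain ⟨a, rfl⟩ := (eS A n).surjective a
  obtain ⟨b, rfl⟩ := (eS A n).surjective b
  simp only [tρ, pρ, Fin.prod_univ_succ, eS_zero, eS_succ, Matrix.reindex_apply,
    Matrix.submatrix_apply, Equiv.symm_apply_apply, kroneckerMap_apply]
  ring

theorem tq_succ {X Y : Type*} (q : X → Y → ℝ) (n : ℕ) (x : (Fin n → X) × X)
    (y : (Fin n → Y) × Y) :
    tq q (n + 1) (eS X n x) (eS Y n y) = tq q n x.1 y.1 * q x.2 y.2 := by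
  simp only [tq, Fin.prod_univ_succ, eS_zero, eS_succ]
  ring

section power
variable {X A : Type*} [Fintype X] [Fintype A] [DecidableEq A] {P : X → ℝ} {ρ : X → Matrix A A ℂ}

theorem tP_sum (hP : ∑ x, P x = 1) (n : ℕ) : ∑ x, tP P n x = 1 := by
  induction n with
  | zero => simp [tP]
  | succ n ih =>
    rw [← Equiv.sum_comp (eS X n), Fintype.sum_prod_type]
    simp only [tP_succ, pP, ← Finset.mul_sum, hP, mul_one, ih]

theorem Ens_pow (h : Ens P ρ) (n : ℕ) : Ens (tP P n) (tρ ρ n) := by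
  induction n with
  | zero =>
    intro x
    have h1 : tρ ρ 0 x = 1 := by
      ext a b
      rw [Subsingleton.elim a b]
      simp [tρ]
    refine ⟨by simp [tP], ?_, ?_⟩
    · rw [h1]; exact PosSemidef.one
    · rw [h1]; simp [tP]
  | succ n ih =>
    intro x
    obtain ⟨x, rfl⟩ := (eS X n).surjective x
    have := (ih.prod h) x
    rw [tP_succ, tρ_succ]
    refine ⟨this.1, this.2.1.submatrix _, ?_⟩
    rw [← this.2.2]
    simp only [Matrix.trace, Matrix.diag_apply, Matrix.reindex_apply, Matrix.submatrix_apply]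
    exact Equiv.sum_comp (eS A n).symm (fun i => pρ (tρ ρ n) ρ x i i)

theorem tq_chan {Y : Type*} [Fintype Y] {q : X → Y → ℝ} (hq : IsChannel q) (n : ℕ) :
    IsChannel (tq q n) := by
  refine ⟨fun x y => Finset.prod_nonneg fun k _ => hq.1 _ _, ?_⟩
  induction n with
  | zero => intro x; simp [tq]
  | succ n ih =>
    intro x
    obtain ⟨x, rfl⟩ := (eS X n).surjective x
    rw [← Equiv.sum_comp (eS Y n), Fintype.sum_prod_type]
    simp only [tq_succ, ← Finset.mul_sum, hq.2, mul_one, ih]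

/-- zeroth power is trivial -/
theorem c_zero {Y : Type*} [Fintype Y] (q : (Fin 0 → X) → Y → ℝ) :
    cB (tP P 0) (tρ ρ 0) q = 0 ∧ cX (tP P 0) q = 0 := by
  constructor
  · simp only [cB]
    refine Finset.sum_eq_zero fun y _ => ?_
    have : blk (tρ ρ 0) (fun x => q x y) = diagonal (fun _ => ((q default y : ℝ) : ℂ)) := by
      ext a b
      simp [blk, tρ, Subsingleton.elim a b]
    rw [this, entropy_diag]
    simp [tP]
  · simp [cX, tP]

theorem direct {Y : Type*} [Fintype Y] (h : Ens P ρ) (hP : ∑ x, P x = 1) {q : X → Y → ℝ}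
    (hq : IsChannel q) (n : ℕ) :
    cB (tP P n) (tρ ρ n) (tq q n) = n * cB P ρ q ∧ cX (tP P n) (tq q n) = n * cX P q := by
  induction n with
  | zero => simpa using c_zero _
  | succ n ih =>
    have hc := tq_chan hq n
    have e1 := cB_equiv (eS X n) (eS A n) (eS Y n) ((Ens_pow h n).prod h)
      (q := fun x y => tq q n x.1 y.1 * q x.2 y.2) (q' := tq q (n + 1))
      (fun x y => mul_nonneg (hc.1 _ _) (hq.1 _ _))
      (tP_succ P n) (tρ_succ ρ n) (tq_succ q n)
    have e2 := cB_prod (Ens_pow h n) h (tP_sum hP n) hP (tq q n) q hc hq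
    rw [e1.1, e1.2, e2.1, e2.2, ih.1, ih.2]
    push_cast
    constructor <;> ring

theorem converse {Y : Type*} [Fintype Y] (h : Ens P ρ) (hP : ∑ x, P x = 1) (n : ℕ)
    (q : (Fin n → X) → Y → ℝ) (hq : IsChannel q) :
    ∃ (m : ℕ) (q' : X → Fin m → ℝ), (∀ x u, 0 ≤ q' x u) ∧ (∀ x, ∑ u, q' x u = n) ∧
      cB P ρ q' ≤ cB (tP P n) (tρ ρ n) q ∧ cX P q' = cX (tP P n) q := by
  induction n with
  | zero =>
    refine ⟨0, fun _ _ => 0, by simp, by simp, ?_, ?_⟩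
    · rw [(c_zero q).1]; simp [cB]
    · rw [(c_zero (P := P) (ρ := ρ) q).2]; simp [cX]
  | succ n ih =>
    set r : (Fin n → X) × X → Y → ℝ := fun x y => q (eS X n x) y with hr
    have e1 := cB_equiv (eS X n) (eS A n) (Equiv.refl Y) ((Ens_pow h n).prod h)
      (q := r) (q' := q) (fun x y => hq.1 _ _)
      (tP_succ P n) (tρ_succ ρ n) (fun x y => rfl)
    have hm : IsChannel (margQ P r) := by
      refine ⟨fun x y => Finset.sum_nonneg fun x' _ => mul_nonneg (hq.1 _ _) (h x').1, ?_⟩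
      intro x
      simp only [margQ]
      rw [Finset.sum_comm]
      simp only [← Finset.sum_mul, hr, hq.2, one_mul, hP]
    obtain ⟨m, q', h1, h2, h3, h4⟩ := ih (margQ P r) hm
    have hc : ∀ x u, 0 ≤ condQ (tP P n) r x u := fun x u =>
      mul_nonneg (Ens_pow h n _).1 (hq.1 _ _)
    have hc2 : ∀ x, ∑ u, condQ (tP P n) r x u = 1 := by
      intro x
      simp only [condQ]
      rw [Fintype.sum_prod_type, Finset.sum_comm]
      simp only [← Finset.mul_sum, hr, hq.2, mul_one, tP_sum hP]
    set eU := Fintype.equivFin (Fin m ⊕ (Y × (Fin n → X))) with heU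
    set s : X → Fin m ⊕ (Y × (Fin n → X)) → ℝ :=
      fun x => Sum.elim (q' x) (condQ (tP P n) r x) with hs
    have hs0 : ∀ x u, 0 ≤ s x u := by
      rintro x (u | u)
      · exact h1 x u
      · exact hc x u
    have e2 := cB_equiv (Equiv.refl X) (Equiv.refl A) eU h
      (P' := P) (ρ' := ρ) (q := s) (q' := fun x u => s x (eU.symm u)) hs0
      (fun x => rfl) (fun x => rfl)
      (fun x y => by simp only [Equiv.refl_apply, Equiv.symm_apply_apply])
    have e3 := c_sum P ρ q' (condQ (tP P n) r)
    refine ⟨_, fun x u => s x (eU.symm u), fun x u => hs0 _ _, ?_, ?_, ?_⟩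
    · intro x
      rw [Equiv.sum_comp eU.symm (s x), Fintype.sum_sum_type]
      simp only [hs, Sum.elim_inl, Sum.elim_inr, h2, hc2]
      push_cast; rfl
    · rw [e2.1, e1.1, e3.1]
      have := cB_step (Ens_pow h n) h r (fun x y => hq.1 _ _)
      linarith
    · rw [e2.2, e1.2, e3.2, h4, cX_step]

end power


section eval
variable {X B E Y : Type*} [Fintype X] [DecidableEq X] [Fintype B] [DecidableEq B]
  [Fintype E] [DecidableEq E] [Fintype Y] [DecidableEq Y]

/-- conditional states of a vector -/
def sg (Φ : X × (B × E) → ℂ) (x : X) : Matrix B B ℂ :=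
  fun b b' => ∑ e, Φ (x, (b, e)) * star (Φ (x, (b', e)))

/-- conditional vectors orthogonal with norms P -/
def Orth (P : X → ℝ) (Φ : X × (B × E) → ℂ) : Prop :=
  ∀ x x', ∑ w, Φ (x, w) * star (Φ (x', w)) = if x = x' then (P x : ℂ) else 0

theorem sg_psd (Φ : X × (B × E) → ℂ) (x : X) : (sg Φ x).PosSemidef := by
  have : sg Φ x = (Matrix.of fun b e => Φ (x, (b, e))) * (Matrix.of fun b e => Φ (x, (b, e)))ᴴ := by
    ext b b'
    simp [sg, Matrix.mul_apply]
  rw [this]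
  exact posSemidef_self_mul_conjTranspose _

theorem sg_ens {P : X → ℝ} {Φ : X × (B × E) → ℂ} (hP : ∀ x, 0 ≤ P x) (h : Orth P Φ) :
    Ens P (sg Φ) := by
  intro x
  refine ⟨hP x, sg_psd Φ x, ?_⟩
  have := h x x
  rw [if_pos rfl, Fintype.sum_prod_type] at this
  rw [← this]
  rfl

theorem evalB {P : X → ℝ} {Φ : X × (B × E) → ℂ} (hP : ∀ x, 0 ≤ P x) (hP1 : ∑ x, P x = 1)
    (h : Orth P Φ) {q : X → Y → ℝ} (hq : IsChannel q) :
    miYB (chanState Φ q) = cB P (sg Φ) (fun _ (_ : Unit) => 1) - cB P (sg Φ) q := by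
  have hE := sg_ens hP h
  have e : ptraceRight (Matrix.reindex (exYB Y X B E) (exYB Y X B E) (chanState Φ q)) =
      bdiag (fun y => blk (sg Φ) (fun x => q x y)) := by
    ext ⟨y, b⟩ ⟨y', b'⟩
    by_cases hy : y = y'
    · subst hy
      simp only [ptraceRight, bdiag, Matrix.reindex_apply, Matrix.submatrix_apply, exYB,
        Equiv.coe_fn_symm_mk, chanState, and_self, if_true, blk, Matrix.sum_apply,
        Matrix.smul_apply, sg, smul_eq_mul, Fintype.sum_prod_type, Finset.mul_sum, mul_assoc]
    · simp [ptraceRight, bdiag, exYB, chanState, hy]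
  have e2 : ∑ y, blk (sg Φ) (fun x => q x y) = blk (sg Φ) (fun _ => 1) := by
    simp only [blk]
    rw [Finset.sum_comm]
    refine Finset.sum_congr rfl fun x _ => ?_
    rw [← Finset.sum_smul, ← Complex.ofReal_sum, hq.2]
  rw [miYB, e, mutualInfo_bdiag _ (fun y => blk_psd hE _ fun x => hq.1 _ _), e2]
  simp only [blk_trace_re hE, cB, Finset.sum_sub_distrib, one_mul, hP1]
  simp
  ring

theorem entV {P : X → ℝ} {Φ : X × (B × E) → ℂ} (h : Orth P Φ) (k : X → ℝ) (hk : ∀ x, 0 ≤ k x) :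
    (∑ x, (k x : ℂ) • vecMulVec (fun w => Φ (x, w)) (star (fun w => Φ (x, w)))).PosSemidef ∧
    (∑ x, (k x : ℂ) • vecMulVec (fun w => Φ (x, w)) (star (fun w => Φ (x, w)))).trace.re
      = ∑ x, k x * P x ∧
    entropy (∑ x, (k x : ℂ) • vecMulVec (fun w => Φ (x, w)) (star (fun w => Φ (x, w))))
      = ∑ x, Real.negMulLog (k x * P x) := by
  have hpsd : (∑ x, (k x : ℂ) • vecMulVec (fun w => Φ (x, w))
      (star (fun w => Φ (x, w)))).PosSemidef :=
    posSemidef_sum _ fun x _ => (posSemidef_vecMulVec_self_star _).smul (by exact_mod_cast hk x)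
  refine ⟨hpsd, ?_, ?_⟩
  · rw [Matrix.trace_sum, Complex.re_sum]
    refine Finset.sum_congr rfl fun x _ => ?_
    have := h x x
    rw [if_pos rfl] at this
    have t : (vecMulVec (fun w => Φ (x, w)) (star (fun w => Φ (x, w)))).trace = P x := by
      rw [← this]; rfl
    rw [Matrix.trace_smul, t, smul_eq_mul, ← Complex.ofReal_mul, Complex.ofReal_re]
  · refine entropy_of_mul hpsd.1 (Matrix.of fun w x => Φ (x, w))
      (Matrix.of fun x w => (k x : ℂ) * star (Φ (x, w))) _ ?_ ?_
    · ext w w'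
      simp only [Matrix.sum_apply, Matrix.mul_apply, Matrix.smul_apply, vecMulVec_apply,
        Matrix.of_apply, Pi.star_apply, smul_eq_mul]
      exact Finset.sum_congr rfl fun x _ => by ring
    · ext x x'
      simp only [Matrix.mul_apply, Matrix.of_apply, diagonal_apply]
      have := h x' x
      have e : ∑ w, (k x : ℂ) * star (Φ (x, w)) * Φ (x', w) =
          (k x : ℂ) * ∑ w, Φ (x', w) * star (Φ (x, w)) := by
        rw [Finset.mul_sum]
        exact Finset.sum_congr rfl fun w _ => by ring
      rw [e, this]
      by_cases hx : x = x'
      · subst hx; simp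
      · rw [if_neg hx, if_neg (Ne.symm hx), mul_zero]

theorem evalX {P : X → ℝ} {Φ : X × (B × E) → ℂ} (hP1 : ∑ x, P x = 1)
    (h : Orth P Φ) {q : X → Y → ℝ} (hq : IsChannel q) :
    miYBE (chanState Φ q) = cX P (fun _ (_ : Unit) => 1) - cX P q := by
  set V : (X → ℝ) → Matrix (B × E) (B × E) ℂ := fun k =>
    ∑ x, (k x : ℂ) • vecMulVec (fun w => Φ (x, w)) (star (fun w => Φ (x, w))) with hV
  have e : ptraceRight (Matrix.reindex (exYW Y X (B × E)) (exYW Y X (B × E)) (chanState Φ q)) =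
      bdiag (fun y => V (fun x => q x y)) := by
    ext ⟨y, b⟩ ⟨y', b'⟩
    by_cases hy : y = y'
    · subst hy
      simp only [ptraceRight, bdiag, Matrix.reindex_apply, Matrix.submatrix_apply, exYW,
        Equiv.coe_fn_symm_mk, chanState, and_self, if_true, hV, Matrix.sum_apply,
        Matrix.smul_apply, vecMulVec_apply, smul_eq_mul, mul_assoc, Pi.star_apply]
    · simp [ptraceRight, bdiag, exYW, chanState, hy]
  have e2 : ∑ y, V (fun x => q x y) = V (fun _ => 1) := by
    simp only [hV]
    rw [Finset.sum_comm]
    refine Finset.sum_congr rfl fun x _ => ?_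
    rw [← Finset.sum_smul, ← Complex.ofReal_sum, hq.2]
  have k1 := fun y => entV h (fun x => q x y) (fun x => hq.1 x y)
  have k2 := entV h (fun _ => 1) (fun _ => zero_le_one)
  rw [miYBE, e, mutualInfo_bdiag _ (fun y => (k1 y).1), e2, k2.2.2]
  simp only [fun y => (k1 y).2.1, fun y => (k1 y).2.2, hV, cX, Finset.sum_sub_distrib, one_mul, hP1]
  simp
  ring

end eval

section final
variable {X B E : Type*} [Fintype X] [DecidableEq X] [Fintype B] [DecidableEq B]
  [Fintype E] [DecidableEq E]

theorem sg_pow (ψ : X × (B × E) → ℂ) (n : ℕ) : sg (vecPowBE ψ n) = tρ (sg ψ) n := by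
  ext x b b'
  simp only [sg, tρ, vecPowBE]
  rw [Finset.prod_univ_sum, Fintype.piFinset_univ]
  refine Finset.sum_congr rfl fun e _ => ?_
  rw [star_prod, Finset.prod_mul_distrib]

theorem orth_pow {P : X → ℝ} {ψ : X × (B × E) → ℂ} (h : Orth P ψ) (n : ℕ) :
    Orth (tP P n) (vecPowBE ψ n) := by
  intro x x'
  have e : ∑ w, vecPowBE ψ n (x, w) * star (vecPowBE ψ n (x', w)) =
      ∏ k, ∑ w, ψ (x k, w) * star (ψ (x' k, w)) := by
    rw [Finset.prod_univ_sum, Fintype.piFinset_univ,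
      ← Equiv.sum_comp (Equiv.arrowProdEquivProdArrow (Fin n) (fun _ => B) (fun _ => E))]
    refine Finset.sum_congr rfl fun w _ => ?_
    simp only [vecPowBE, Equiv.arrowProdEquivProdArrow]
    rw [star_prod, Finset.prod_mul_distrib]
    rfl
  rw [e]
  simp only [h _ _]
  by_cases hx : x = x'
  · subst hx; simp [tP]
  · rw [if_neg hx]
    obtain ⟨k, hk⟩ := Function.ne_iff.mp hx
    exact Finset.prod_eq_zero (Finset.mem_univ k) (if_neg hk)

theorem eval_pow {P : X → ℝ} {ψ : X × (B × E) → ℂ} (hP : ∀ x, 0 ≤ P x) (hP1 : ∑ x, P x = 1)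
    (h : Orth P ψ) (n : ℕ) {Y : Type*} [Fintype Y] [DecidableEq Y] {q : (Fin n → X) → Y → ℝ}
    (hq : IsChannel q) :
    miYB (chanState (vecPowBE ψ n) q) = n * cB P (sg ψ) (fun _ (_ : Unit) => 1)
      - cB (tP P n) (tρ (sg ψ) n) q ∧
    miYBE (chanState (vecPowBE ψ n) q) = n * cX P (fun _ (_ : Unit) => 1)
      - cX (tP P n) q := by
  have hE := sg_ens hP h
  have ht := fun x => (Ens_pow hE n x).1
  have hd := direct hE hP1 (q := fun _ (_ : Unit) => 1) ⟨by simp, by simp⟩ n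
  have he := cB_equiv (Equiv.refl (Fin n → X)) (Equiv.refl (Fin n → B))
    (Equiv.ofUnique Unit (Fin n → Unit)) (Ens_pow hE n)
    (P' := tP P n) (ρ' := tρ (sg ψ) n) (q := fun _ (_ : Unit) => 1)
    (q' := tq (fun _ (_ : Unit) => 1) n) (by simp) (fun _ => rfl) (fun _ => rfl)
    (by simp [tq])
  rw [evalB ht (tP_sum hP1 n) (orth_pow h n) hq, evalX (tP_sum hP1 n) (orth_pow h n) hq,
    sg_pow, ← hd.1, ← hd.2, he.1, he.2]
  exact ⟨rfl, rfl⟩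

/-- the feasible value set -/
def PS (ψ : X × (B × E) → ℂ) (n : ℕ) (R : ℝ) : Set ℝ :=
  { v : ℝ | ∃ (m : ℕ) (q : (Fin n → X) → Fin m → ℝ), IsChannel q ∧
    (1 / n : ℝ) * miYBE (chanState (vecPowBE ψ n) q) ≤ R ∧
    v = (1 / n : ℝ) * miYB (chanState (vecPowBE ψ n) q) }

theorem PS_le {P : X → ℝ} {ψ : X × (B × E) → ℂ} (hP : ∀ x, 0 ≤ P x) (hP1 : ∑ x, P x = 1)
    (h : Orth P ψ) (R : ℝ) (n k : ℕ) (hn : 1 ≤ n) (hk : 1 ≤ k) :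
    ∀ v ∈ PS ψ n R, ∃ v' ∈ PS ψ k R, v ≤ v' := by
  rintro v ⟨m, q, hq, hR, rfl⟩
  have hE := sg_ens hP h
  have hn0 : (0 : ℝ) < n := by exact_mod_cast hn
  have hk0 : (0 : ℝ) < k := by exact_mod_cast hk
  obtain ⟨m', q', h1, h2, h3, h4⟩ := converse hE hP1 n q hq
  have hs := c_smul hE h1 (1 / n : ℝ) (by positivity)
  set r : X → Fin m' → ℝ := fun x y => (1 / n : ℝ) * q' x y with hr
  have hrc : IsChannel r := by
    refine ⟨fun x y => mul_nonneg (by positivity) (h1 x y), fun x => ?_⟩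
    simp only [hr, ← Finset.mul_sum, h2]
    field_simp
  have hd := direct hE hP1 hrc k
  set eU := Fintype.equivFin (Fin k → Fin m')
  have htc := tq_chan hrc k
  have he := cB_equiv (Equiv.refl (Fin k → X)) (Equiv.refl (Fin k → B)) eU (Ens_pow hE k)
    (P' := tP P k) (ρ' := tρ (sg ψ) k) (q := tq r k) (q' := fun x u => tq r k x (eU.symm u)) htc.1
    (fun _ => rfl) (fun _ => rfl)
    (fun x y => by simp only [Equiv.refl_apply, Equiv.symm_apply_apply])
  have hc : IsChannel (fun x u => tq r k x (eU.symm u)) :=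
    ⟨fun x u => htc.1 _ _, fun x => by rw [Equiv.sum_comp eU.symm (tq r k x)]; exact htc.2 x⟩
  have ev := eval_pow hP hP1 h n hq
  have ev' := eval_pow hP hP1 h k hc
  rw [he.1, he.2, hd.1, hd.2, hs.1, hs.2] at ev'
  refine ⟨_, ⟨_, _, hc, ?_, rfl⟩, ?_⟩
  · refine le_trans (le_of_eq ?_) hR
    rw [ev.2, ev'.2, h4]
    field_simp
  · rw [ev.1, ev'.1]
    have : (1 / k : ℝ) * (k * cB P (sg ψ) (fun _ (_ : Unit) => 1) -
        k * (1 / n * cB P (sg ψ) q')) =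
        (1 / n : ℝ) * (n * cB P (sg ψ) (fun _ (_ : Unit) => 1) - cB P (sg ψ) q') := by
      field_simp
    rw [this]
    exact mul_le_mul_of_nonneg_left (by linarith) (by positivity)

theorem sSup_eq_of {S T : Set ℝ} (h1 : ∀ v ∈ S, ∃ w ∈ T, v ≤ w) (h2 : ∀ v ∈ T, ∃ w ∈ S, v ≤ w) :
    sSup S = sSup T := by
  have hub : upperBounds S = upperBounds T := by
    ext u
    constructor
    · intro hu v hv
      obtain ⟨w, hw, hvw⟩ := h2 v hv
      exact hvw.trans (hu hw)
    · intro hu v hv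
      obtain ⟨w, hw, hvw⟩ := h1 v hv
      exact hvw.trans (hu hw)
  by_cases hb : BddAbove S
  · have hb' : BddAbove T := by rw [BddAbove, ← hub]; exact hb
    rcases S.eq_empty_or_nonempty with hS | hS
    · have hT : T = ∅ := by
        rw [Set.eq_empty_iff_forall_notMem]
        intro v hv
        obtain ⟨w, hw, _⟩ := h2 v hv
        simp [hS] at hw
      rw [hS, hT]
    · have hT : T.Nonempty := by
        obtain ⟨v, hv⟩ := hS
        obtain ⟨w, hw, _⟩ := h1 v hv
        exact ⟨w, hw⟩
      have hl := isLUB_csSup hS hb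
      have hl' := isLUB_csSup hT hb'
      rw [IsLUB, ← hub] at hl'
      exact IsLeast.unique hl hl'
  · have hb' : ¬ BddAbove T := by rw [BddAbove, ← hub]; exact hb
    rw [Real.sSup_of_not_bddAbove hb, Real.sSup_of_not_bddAbove hb']

theorem orth_of (p : X → ℝ) (ρx : X → Matrix B B ℂ) (hρx : ∀ x, IsDensity (ρx x))
    (ψ : X × (B × E) → ℂ)
    (hpur : ptraceRight (Matrix.reindex (Equiv.prodAssoc X B E).symm
      (Equiv.prodAssoc X B E).symm (vecMulVec ψ (star ψ))) = cqState p ρx) : Orth p ψ := by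
  intro x x'
  rw [Fintype.sum_prod_type]
  have : ∀ b, ∑ e, ψ (x, (b, e)) * star (ψ (x', (b, e))) = cqState p ρx (x, b) (x', b) := by
    intro b
    rw [← hpur]
    rfl
  simp only [this, cqState]
  by_cases hx : x = x'
  · subst hx
    simp only [if_true, ← Finset.mul_sum]
    have := (hρx x).2
    rw [Matrix.trace] at this
    simp only [Matrix.diag_apply] at this
    rw [this, mul_one]
  · simp [hx]

end final


/-- **Single-letterization for classical-quantum systems.** For a classical-quantum state
with purification vector `ψ`, `P_n(R) = P_1(R)` for all `R ≥ 0` and all `n ≥ 1`. -/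
theorem Pn_single_letter {𝒳 B E : Type*} [Fintype 𝒳] [DecidableEq 𝒳] [Fintype B]
    [DecidableEq B] [Fintype E] [DecidableEq E]
    (p : 𝒳 → ℝ) (hp : ∀ x, 0 ≤ p x) (hp1 : ∑ x, p x = 1)
    (ρx : 𝒳 → Matrix B B ℂ) (hρx : ∀ x, IsDensity (ρx x))
    (ψ : 𝒳 × (B × E) → ℂ) (hψ : star ψ ⬝ᵥ ψ = 1)
    (hpur : ptraceRight (Matrix.reindex (Equiv.prodAssoc 𝒳 B E).symm
      (Equiv.prodAssoc 𝒳 B E).symm (vecMulVec ψ (star ψ))) = cqState p ρx)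
    (R : ℝ) (hR : 0 ≤ R) (n : ℕ) (hn : 1 ≤ n) :
    Pn ψ n R = Pn ψ 1 R := by
  have h := orth_of p ρx hρx ψ hpur
  have a := PS_le hp hp1 h R n 1 hn le_rfl
  have b := PS_le hp hp1 h R 1 n le_rfl hn
  exact sSup_eq_of a b

end LPD
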